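/- Let k be an algebraic closure of F₂. For every (a₀, c₀) ∈ k², the set of points p = (a,b,c,d,v,w,x,y) ∈ k⁸ such that g(p) = 0 for every g ∈ J, the product x·c of the x- and c-coordinates of p is nonzero, and a = a₀, c = c₀, is finite. (That is, the projection π : U → 𝔸², π(a,b,c,d,v,w,x,y) = (a,c), is quasifinite, where U = V′ ∖ V(xc).) -/

import Mathlib

open MvPolynomial

noncomputable section

/-- The polynomial ring `R = 𝔽₂[a,b,c,d,v,w,x,y]`, with variables indexed
`a = X 0, b = X 1, c = X 2, d = X 3, v = X 4, w = X 5, x = X 6, y = X 7`. -/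
abbrev SuzukiRing := MvPolynomial (Fin 8) (ZMod 2)

/-- The 4×4 anti-diagonal permutation matrix `T`. -/
def Tmat : Matrix (Fin 4) (Fin 4) SuzukiRing :=
  !![0, 0, 0, 1; 0, 0, 1, 0; 0, 1, 0, 0; 1, 0, 0, 0]

/-- The lower unitriangular matrix `S(α, β, α₀, β₀)`. -/
def Smat (α β α₀ β₀ : SuzukiRing) : Matrix (Fin 4) (Fin 4) SuzukiRing :=
  !![1, 0, 0, 0;
     α, 1, 0, 0;
     α * α₀ + β, α₀, 1, 0;
     α ^ 2 * α₀ + α * β + β₀, β, α, 1]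

/-- `X = T · S(a, b, v, w)`. -/
def Xmat : Matrix (Fin 4) (Fin 4) SuzukiRing := Tmat * Smat (X 0) (X 1) (X 4) (X 5)

/-- `Y = T · S(c, d, x, y)`. -/
def Ymat : Matrix (Fin 4) (Fin 4) SuzukiRing := Tmat * Smat (X 2) (X 3) (X 6) (X 7)

/-- The ideal `I_V ⊆ R` generated by the 16 entries of
`X⁻¹YX⁻¹Y⁻¹X² − YX⁻²Y⁻¹XY⁻¹` (the inverses being the adjugates, since both
matrices have determinant 1). -/
def IV : Ideal SuzukiRing :=
  Ideal.span (Set.range fun p : Fin 4 × Fin 4 =>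
    (Xmat.adjugate * Ymat * Xmat.adjugate * Ymat.adjugate * Xmat * Xmat
      - Ymat * Xmat.adjugate * Xmat.adjugate * Ymat.adjugate * Xmat * Ymat.adjugate)
      p.1 p.2)



set_option linter.unusedVariables false
set_option linter.unusedSectionVars false
set_option linter.unusedSimpArgs false

section Algebra

variable {K : Type*} [Field K] [CharP K 2]

/-- The matrix `T * S(α, β, α₀, β₀)` in trace coordinates. -/
noncomputable def matM (α β α₀ τ : K) : Matrix (Fin 4) (Fin 4) K :=
  !![τ + α₀, β, α, 1; α * α₀ + β, α₀, 1, 0; α, 1, 0, 0; 1, 0, 0, 0]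

/-- Its inverse. -/
noncomputable def matMi (α β α₀ τ : K) : Matrix (Fin 4) (Fin 4) K :=
  !![0, 0, 0, 1; 0, 0, 1, α; 0, 1, α₀, β; 1, α, α * α₀ + β, τ + α₀]
/-- The product of two explicit `4 × 4` matrices. -/
lemma mul_four (p00 p01 p02 p03 p10 p11 p12 p13 p20 p21 p22 p23 p30 p31 p32 p33
      q00 q01 q02 q03 q10 q11 q12 q13 q20 q21 q22 q23 q30 q31 q32 q33 : K) :
    !![p00, p01, p02, p03; p10, p11, p12, p13; p20, p21, p22, p23; p30, p31, p32, p33] *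
      !![q00, q01, q02, q03; q10, q11, q12, q13; q20, q21, q22, q23; q30, q31, q32, q33] =
    !![p00 * q00 + p01 * q10 + p02 * q20 + p03 * q30, p00 * q01 + p01 * q11 + p02 * q21 + p03 * q31, p00 * q02 + p01 * q12 + p02 * q22 + p03 * q32, p00 * q03 + p01 * q13 + p02 * q23 + p03 * q33;
      p10 * q00 + p11 * q10 + p12 * q20 + p13 * q30, p10 * q01 + p11 * q11 + p12 * q21 + p13 * q31, p10 * q02 + p11 * q12 + p12 * q22 + p13 * q32, p10 * q03 + p11 * q13 + p12 * q23 + p13 * q33;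
      p20 * q00 + p21 * q10 + p22 * q20 + p23 * q30, p20 * q01 + p21 * q11 + p22 * q21 + p23 * q31, p20 * q02 + p21 * q12 + p22 * q22 + p23 * q32, p20 * q03 + p21 * q13 + p22 * q23 + p23 * q33;
      p30 * q00 + p31 * q10 + p32 * q20 + p33 * q30, p30 * q01 + p31 * q11 + p32 * q21 + p33 * q31, p30 * q02 + p31 * q12 + p32 * q22 + p33 * q32, p30 * q03 + p31 * q13 + p32 * q23 + p33 * q33] := by
  ext i j
  fin_cases i <;> fin_cases j <;> simp [Matrix.mul_apply, Fin.sum_univ_four]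

noncomputable def ent0_01 (a b c d v t x s : K) : K :=
  a*a*b*v + a*a*d*t + a*b*c*t + a*b*c*x + a*a*a + a*a*c + a*b*b + a*b*d + a*v*v + a*v*t + a*t*t + a*t*x + a*t*s + c*v*x + a

noncomputable def ent1_23 (a b c d v t x s : K) : K :=
  a*b*c*v + a*c*d*v + a*c*d*t + b*c*c*t + a*a*c + a*c*c + a*v*t + a*v*x + b*b*c + b*c*d + c*v*v + c*v*s + c*t*t + c*t*s + c

noncomputable def ent0_11 (a b c d v t x s : K) : K :=
  a*b*c*c*v + a*b*c*c*x + a*a*t*x + a*b*c*d + a*c*t*x + b*b*c*c + c*c*v*v + c*c*v*x + a*b*t + a*b*x + a*d*t + b*c*t + b*c*s + c*d*v + a*a + a*c + c*c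

noncomputable def ent1_11 (a b c d v t x s : K) : K :=
  a*a*a*d*v + a*a*a*d*x + a*a*b*c*v + a*a*b*c*x + a*a*c*d*v + a*b*c*c*v + a*a*d*d + a*a*v*x + a*a*v*s + a*a*x*s + a*b*c*d + a*c*v*t + a*c*v*x + a*c*v*s + a*c*x*x + c*c*v*t + c*c*v*x + c*c*t*x + a*b*v + a*b*t + a*b*x + a*d*v + a*d*t + a*d*x + a*d*s + b*c*t + b*c*x + b*b + b*d + d*d + v*v + v*x + x*x

noncomputable def ent1_00 (a b c d v t x s : K) : K :=
  a*a*a*d*v + a*a*a*d*x + a*a*b*c*v + a*a*b*c*x + a*a*c*d*v + a*a*c*d*x + a*b*c*c*v + a*b*c*c*x + a*a*v*v + a*a*v*t + a*a*v*x + a*a*v*s + a*a*t*x + a*a*x*s + a*c*v*x + a*c*v*s + a*c*x*x + a*c*x*s + c*c*v*v + c*c*v*t + c*c*t*x + c*c*x*x + a*b*v + a*d*v + a*d*x + a*d*s + b*c*x + b*c*s + c*d*v + a*a + a*c + b*b + b*d + c*c + d*d + v*v + v*x + v*s + t*t + t*x + t*s + x*x + s*s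

noncomputable def ent0_00 (a b c d v t x s : K) : K :=
  a*c*v*t + a*c*t*x + a*d*v + b*c*x

noncomputable def ent2_30 (a b c d v t x s : K) : K :=
  a*a*v*v*v + a*a*v*v*t + a*a*v*v*x + a*a*v*t*x + a*c*v*v*t + a*c*v*t*t + a*c*v*t*x + a*c*t*t*x + c*c*v*v*v + c*c*v*v*x + c*c*v*t*t + c*c*t*t*x + a*b*v*v + a*a*x + a*c*v + a*c*x + b*b*v + v*v*v + v*v*t + v*t*t + t*t*t + x + s

noncomputable def ent2_32 (a b c d v t x s : K) : K :=
  a*a*a*v*v + a*a*a*v*x + a*a*c*v*v + a*a*c*v*t + a*a*c*v*x + a*a*c*t*x + a*c*c*v*t + a*c*c*t*x + a*a*b*v + a*a*d*v + a*a*d*x + a*c*d*v + a*c*d*x + a*a*a + a*b*b + a*v*v + a*v*t + a*v*s + a*t*t + a*t*x + a*x*x + c*v*t + c*v*s + c*t*x + c*x*x + b*t + b*x + b*s + d*v + d*s + c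

noncomputable def ent2_31 (a b c d v t x s : K) : K :=
  a*b*c*v*v + a*b*c*v*t + a*b*c*v*x + a*b*c*t*x + b*c*c*v*v + b*c*c*v*t + b*c*c*v*x + b*c*c*t*x + a*a*a*v + a*a*a*x + a*b*b*x + a*c*c*v + a*c*c*x + a*v*v*v + a*v*v*t + a*v*v*x + a*v*t*x + b*b*c*v + b*b*c*x + c*v*v*v + c*v*v*t + c*v*v*x + c*v*t*x + a*a*b + b*b*b + b*v*v + b*v*t + b*t*t + a*v + a*t + a*s + c*v + c*s + d

noncomputable def ent0_22 (a b c d v t x s : K) : K :=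
  a*a*a*c*v*v + a*a*a*c*x*x + a*a*c*c*v*v + a*a*c*c*x*x + a*a*a*d*v + a*a*a*d*x + a*a*b*c*v + a*a*b*c*x + a*b*c*c*v + a*b*c*c*x + a*a*d*d + a*a*v*t + a*a*v*s + a*a*x*s + a*b*c*d + a*c*v*s + a*c*t*x + a*c*x*s + c*c*v*t + c*c*v*x + c*c*t*x + c*c*x*x + a*b*v + a*b*t + a*b*x + a*d*t + a*d*x + a*d*s + b*c*t + b*b + b*d + d*d + v*v + v*x + x*x

noncomputable def ent1_10 (a b c d v t x s : K) : K :=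
  a*a*c*v*t + a*a*c*t*x + a*c*c*v*v + a*c*c*v*x + c*c*c*v*v + c*c*c*v*t + c*c*c*v*x + c*c*c*t*x + a*a*b*x + a*a*d*v + a*a*d*x + a*b*c*v + a*c*d*v + b*c*c*v + a*a*a + a*a*c + a*b*b + a*d*d + a*v*v + a*v*x + a*v*s + a*t*t + a*t*x + a*x*s + b*b*c + b*c*d + c*v*v + c*v*t + c*v*s + c*t*t + c*x*x + b*t + b*x + d*v + d*t + d*s + a

noncomputable def ent0_23 (a b c d v t x s : K) : K :=
  a*a*a*v*v + a*a*a*v*x + a*a*c*v*t + a*a*c*v*x + a*a*c*t*x + a*a*c*x*x + a*c*c*v*x + a*c*c*x*x + c*c*c*v*v + c*c*c*v*t + c*c*c*v*x + c*c*c*t*x + a*a*b*x + a*a*d*v + a*a*d*x + a*b*c*v + b*c*c*v + b*c*c*x + a*a*a + a*a*c + a*b*b + a*d*d + a*v*v + a*v*t + a*v*s + a*t*t + a*t*x + a*x*s + b*b*c + b*c*d + c*v*v + c*v*t + c*v*x + c*v*s + c*t*t + c*t*x + c*x*x + c*x*s + b*t + b*x + d*v + d*t + d*s + a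

noncomputable def ent2_21 (a b c d v t x s : K) : K :=
  a*a*b*c*v*t + a*a*b*c*t*x + a*b*c*c*v*t + a*b*c*c*t*x + a*a*a*c*v + a*a*a*c*x + a*a*b*b*x + a*a*v*v*t + a*a*v*t*x + a*c*c*c*v + a*c*c*c*x + a*c*v*v*t + a*c*v*t*x + b*b*c*c*v + b*b*c*c*x + a*a*a*b + a*b*b*b + a*b*t*t + a*a*t + a*a*x + a*c*v + a*c*x + a*c*s + b*b*v + b*b*t + c*c*s + v*v*v + a*d + x

noncomputable def ent1_21 (a b c d v t x s : K) : K :=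
  a*a*v*v*t + a*a*t*x*x + a*c*v*v*t + a*c*t*x*x + a*a*c*d + a*b*c*c + a*b*v*v + a*b*x*x + a*d*v*v + a*d*v*t + a*d*v*x + a*d*t*x + b*c*v*t + b*c*v*x + b*c*t*x + b*c*x*x + c*d*v*v + c*d*v*t + c*d*v*x + c*d*t*x + a*a*x + a*c*v + a*c*t + a*c*x + a*c*s + b*b*v + b*b*t + b*b*x + b*d*t + c*c*v + v*v*v + v*v*x + a*b + b*c + c*d + v

noncomputable def ent0_12 (a b c d v t x s : K) : K :=
  a*a*c*c*v + a*a*c*c*x + a*a*v*v*x + a*a*v*x*x + a*a*t*x*x + a*c*v*t*x + c*c*v*v*x + c*c*v*t*x + c*c*v*x*x + c*c*t*x*x + a*a*c*d + a*b*c*c + a*b*v*v + a*b*x*x + a*d*v*v + a*d*v*x + a*d*t*x + b*c*v*t + b*c*v*x + b*c*x*x + c*d*v*v + c*d*v*t + c*d*v*x + c*d*t*x + a*a*v + a*a*x + a*c*t + a*c*x + a*c*s + b*b*v + b*b*t + b*b*x + b*d*t + c*c*v + c*c*x + v*v*v + v*v*x + a*b + b*c + c*d + v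

noncomputable def ent0_21 (a b c d v t x s : K) : K :=
  a*a*b*c*v*v + a*a*b*c*x*x + a*b*c*c*v*v + a*b*c*c*x*x + a*a*b*d*v + a*a*b*d*x + a*b*b*c*v + a*b*b*c*x + a*c*v*v*v + a*c*v*x*x + b*b*c*c*v + b*b*c*c*x + c*c*v*v*v + c*c*v*x*x + a*b*d*d + a*b*v*t + a*b*v*s + a*b*t*x + a*b*x*s + a*d*v*v + a*d*v*x + b*b*c*d + b*c*v*t + b*c*v*x + b*c*v*s + b*c*t*x + b*c*x*x + b*c*x*s + a*a*v + a*a*t + a*a*x + a*c*t + b*b*x + b*d*t + b*d*s + c*c*v + c*c*x + d*d*v + v*v*x + v*x*x + a*b + a*d + c*d + x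

noncomputable def ent2_20 (a b c d v t x s : K) : K :=
  a*a*a*v*v*t + a*a*a*v*t*x + a*a*c*v*t*t + a*a*c*t*t*x + a*c*c*v*v*t + a*c*c*v*t*t + a*c*c*v*t*x + a*c*c*t*t*x + a*b*c*v*v + a*b*c*v*t + a*b*c*v*x + a*b*c*t*x + b*c*c*v*v + b*c*c*v*t + b*c*c*v*x + b*c*c*t*x + a*a*c*v + a*a*c*x + a*b*b*x + a*c*c*v + a*c*c*x + a*v*v*v + a*v*v*t + a*v*v*x + a*v*t*x + a*t*t*t + b*b*c*v + b*b*c*x + c*v*v*v + c*v*v*t + c*v*v*x + c*v*t*x + a*a*b + b*b*b + b*v*v + b*v*t + b*t*t + a*v + a*t + a*x + c*v + c*x + c*s + d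

noncomputable def ent0_02 (a b c d v t x s : K) : K :=
  a*a*b*v*x + a*a*d*v*v + a*a*d*v*x + a*a*d*t*x + a*b*c*v*x + a*b*c*t*x + a*c*d*v*v + a*c*d*v*t + a*c*d*v*x + a*c*d*t*x + b*c*c*v*t + b*c*c*t*x + a*a*a*x + a*a*c*x + a*b*b*v + a*b*b*x + a*b*d*t + a*b*d*x + a*c*c*v + a*c*c*x + a*v*v*t + a*v*v*s + a*v*x*x + a*v*x*s + a*t*t*x + a*t*x*x + a*t*x*s + b*b*c*t + b*b*c*x + b*c*d*v + b*c*d*x + c*v*v*s + c*v*t*t + c*v*t*x + c*v*t*s + c*v*x*x + c*v*x*s + c*t*t*x + c*t*x*x + c*t*x*s + a*a*b + a*b*c + b*b*b + b*b*d + b*v*v + b*v*t + b*t*t + b*t*x + b*t*s + d*v*v + a*x + b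

noncomputable def ent1_20 (a b c d v t x s : K) : K :=
  a*a*c*v*v*t + a*a*c*t*x*x + a*c*c*v*v*t + a*c*c*t*x*x + a*a*b*v*x + a*a*b*x*x + a*b*c*v*v + a*b*c*v*t + a*b*c*v*x + a*b*c*t*x + a*c*d*v*v + a*c*d*v*t + a*c*d*v*x + a*c*d*t*x + b*c*c*v*t + b*c*c*v*x + b*c*c*t*x + b*c*c*x*x + c*c*d*v*v + c*c*d*v*t + c*c*d*v*x + c*c*d*t*x + a*a*a*v + a*a*a*x + a*a*c*v + a*a*c*x + a*b*b*v + a*b*d*x + a*c*c*v + a*c*c*x + a*v*v*t + a*v*v*x + a*v*t*t + a*v*t*x + a*v*x*x + a*t*t*x + b*b*c*v + b*b*c*x + b*c*d*v + b*c*d*x + c*v*v*v + c*v*x*x + a*a*b + a*a*d + a*c*d + b*b*b + b*b*d + b*c*c + b*v*v + b*v*t + b*t*t + b*t*x + d*v*v + d*t*t + a*v + a*t + c*t + c*x + c*s + b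

noncomputable def ent0_13 (a b c d v t x s : K) : K :=
  a*a*a*v*v*x + a*a*a*v*x*x + a*a*c*v*v*x + a*a*c*v*t*x + a*a*c*v*x*x + a*a*c*t*x*x + a*c*c*v*v*x + a*c*c*v*x*x + c*c*c*v*v*x + c*c*c*v*t*x + c*c*c*v*x*x + c*c*c*t*x*x + a*a*b*v*v + a*a*b*v*x + a*a*b*x*x + a*a*d*v*v + a*a*d*v*x + a*b*c*v*v + a*b*c*v*t + a*b*c*v*x + a*b*c*t*x + a*b*c*x*x + a*c*d*v*t + a*c*d*t*x + b*c*c*v*t + b*c*c*t*x + c*c*d*v*v + c*c*d*v*t + c*c*d*v*x + c*c*d*t*x + a*a*a*x + a*a*c*v + a*b*d*x + a*v*v*v + a*v*v*x + a*v*x*x + a*t*t*x + b*b*c*v + b*c*d*v + b*c*d*x + c*v*v*v + c*v*v*x + c*v*x*x + c*t*t*x + a*a*b + a*a*d + a*c*d + b*b*b + b*b*d + b*c*c + b*v*v + b*v*t + b*t*t + b*t*x + d*v*v + d*t*t + a*t + c*t + c*x + c*s + b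

noncomputable def ent2_00 (a b c d v t x s : K) : K :=
  a*a*a*b*v*v*v + a*a*a*b*v*v*x + a*a*b*c*v*v*t + a*a*b*c*v*t*x + a*b*c*c*v*v*v + a*b*c*c*v*v*t + a*b*c*c*v*v*x + a*b*c*c*v*t*x + a*a*a*a*v*v + a*a*a*a*v*x + a*a*a*c*v*t + a*a*a*c*t*x + a*a*b*b*v*v + a*a*c*c*v*v + a*a*c*c*v*t + a*a*c*c*v*x + a*a*c*c*t*x + a*a*v*v*v*v + a*a*v*v*v*x + a*a*v*v*t*t + a*a*v*t*t*x + a*b*b*c*v*v + a*b*b*c*v*t + a*b*b*c*v*x + a*b*b*c*t*x + a*c*v*v*v*t + a*c*v*v*t*x + a*c*v*t*t*t + a*c*t*t*t*x + b*b*c*c*v*v + b*b*c*c*v*t + b*b*c*c*v*x + b*b*c*c*t*x + c*c*v*v*v*v + c*c*v*v*v*t + c*c*v*v*v*x + c*c*v*v*t*t + c*c*v*v*t*x + c*c*v*t*t*t + c*c*v*t*t*x + c*c*t*t*t*x + a*a*a*b*v + a*a*a*b*x + a*a*b*c*v + a*a*b*c*x + a*b*b*b*v + a*b*b*b*x + a*b*v*v*v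 + a*b*v*v*t + a*b*v*v*x + a*b*v*t*t + a*b*v*t*x + b*b*b*c*v + b*b*b*c*x + b*c*v*v*v + b*c*v*v*t + b*c*v*v*x + b*c*v*t*x + a*a*a*a + a*a*v*t + a*a*v*x + a*a*v*s + a*a*t*t + a*a*t*x + a*a*x*x + a*a*x*s + a*c*v*v + a*c*v*s + a*c*x*x + a*c*x*s + b*b*b*b + b*b*t*t + c*c*v*v + c*c*v*t + c*c*v*x + c*c*t*x + v*v*v*v + t*t*t*t + a*b*x + a*d*v + a*d*x + b*c*v + b*c*x + c*d*v + a*a + b*b + c*c + d*d + v*v + t*t + x*x + s*s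

noncomputable def ent0_32 (a b c d v t x s : K) : K :=
  a*a*a*a*c*v*v + a*a*a*a*c*x*x + a*a*a*c*c*v*v + a*a*a*c*c*x*x + a*a*a*a*d*v + a*a*a*a*d*x + a*a*a*b*c*v + a*a*a*b*c*x + a*a*a*c*d*v + a*a*a*c*d*x + a*a*b*c*c*v + a*a*b*c*c*x + a*a*a*v*t + a*a*a*v*s + a*a*a*t*x + a*a*a*x*s + a*a*c*v*v + a*a*c*v*t + a*a*c*t*x + a*a*c*x*x + a*c*c*v*v + a*c*c*x*x + a*a*d*v + a*a*d*s + a*b*c*s + a*c*d*x + a*a*c + a*b*d + a*c*c + a*d*d + a*v*s + a*t*s + a*s*s + c*v*t + c*v*x + c*v*s + c*t*x + c*x*x + c*x*s + b*t + b*x + b*s + d*v + d*s + c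

noncomputable def ent2_23 (a b c d v t x s : K) : K :=
  a*a*a*c*d*v + a*a*a*c*d*x + a*a*b*c*c*v + a*a*b*c*c*x + a*a*c*c*d*v + a*a*c*c*d*x + a*b*c*c*c*v + a*b*c*c*c*x + a*a*c*v*v + a*a*c*v*x + a*a*c*v*s + a*a*c*x*s + a*c*c*v*v + a*c*c*v*s + a*c*c*x*x + a*c*c*x*s + c*c*c*v*x + c*c*c*x*x + a*a*b*x + a*a*d*v + a*a*d*x + a*c*d*x + a*c*d*s + b*c*c*v + b*c*c*x + b*c*c*s + c*c*d*v + a*a*a + a*b*b + a*c*c + a*d*d + a*v*v + a*v*x + a*v*s + a*t*t + a*t*x + a*x*s + c*c*c + c*d*d + c*v*t + c*v*x + c*t*x + c*t*s + c*s*s + b*t + b*x + d*v + d*t + d*s + a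

noncomputable def ent0_10 (a b c d v t x s : K) : K :=
  a*c*c*v*t + a*c*c*t*x + a*b*c*v + a*c*d*t + b*c*c*t + b*c*c*x + a*a*c + a*c*c + a*v*t + a*v*x + b*b*c + b*c*d + c*v*v + c*v*s + c*t*t + c*t*s + c

noncomputable def ent1_01 (a b c d v t x s : K) : K :=
  a*a*a*a*d*v + a*a*a*a*d*x + a*a*a*b*c*v + a*a*a*b*c*x + a*a*a*c*d*v + a*a*a*c*d*x + a*a*b*c*c*v + a*a*b*c*c*x + a*a*a*v*t + a*a*a*v*s + a*a*a*t*x + a*a*a*x*s + a*a*c*v*v + a*a*c*v*t + a*a*c*v*s + a*a*c*t*x + a*a*c*x*x + a*a*c*x*s + a*c*c*v*v + a*c*c*x*x + a*a*d*s + a*b*c*x + a*b*c*s + a*c*d*x + a*a*c + a*b*d + a*c*c + a*d*d + a*v*t + a*v*x + a*t*s + a*s*s + c*v*t + c*v*s + c*t*x + c*x*x + b*t + b*x + b*s + d*v + d*s + c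

noncomputable def ent2_22 (a b c d v t x s : K) : K :=
  a*a*a*c*v*v + a*a*a*c*v*t + a*a*a*c*v*x + a*a*a*c*t*x + a*a*c*c*v*t + a*a*c*c*t*x + a*c*c*c*v*v + a*c*c*c*v*x + a*a*a*b*x + a*a*b*c*v + a*a*b*c*x + a*a*c*d*v + a*a*c*d*x + a*c*c*d*v + a*c*c*d*x + a*a*a*a + a*a*b*b + a*a*v*v + a*a*t*t + a*a*t*x + a*c*v*t + a*c*v*x + a*c*v*s + a*c*t*x + a*c*x*x + c*c*v*x + c*c*v*s + c*c*x*x + a*b*v + a*d*x + b*c*s + c*d*v + c*d*s + a*a + b*b + b*d + c*c + d*d + v*v + v*x + x*x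

noncomputable def ent0_31 (a b c d v t x s : K) : K :=
  a*a*a*b*c*v*v + a*a*a*b*c*x*x + a*a*b*c*c*v*v + a*a*b*c*c*x*x + a*a*a*b*d*v + a*a*a*b*d*x + a*a*b*b*c*v + a*a*b*b*c*x + a*a*b*c*d*v + a*a*b*c*d*x + a*a*c*v*v*v + a*a*c*v*x*x + a*b*b*c*c*v + a*b*b*c*c*x + a*c*c*v*v*v + a*c*c*v*x*x + a*a*b*v*v + a*a*b*v*t + a*a*b*v*x + a*a*b*v*s + a*a*b*t*x + a*a*b*x*s + a*a*d*v*v + a*a*d*v*x + a*b*c*v*v + a*b*c*v*t + a*b*c*v*x + a*b*c*t*x + a*c*d*v*v + a*c*d*v*x + a*a*a*v + a*a*a*x + a*b*b*v + a*b*b*x + a*b*d*x + a*b*d*s + a*c*c*v + a*c*c*x + a*v*v*v + a*v*x*x + b*b*c*v + b*b*c*x + b*b*c*s + b*c*d*v + c*v*v*v + c*v*v*s + c*v*x*x + c*v*x*s + a*b*c + b*b*d + b*c*c + b*d*d + b*t*x + b*t*s + b*x*x + b*s*s + d*v*v + d*v*s + a*v + a*t + a*s + c*x + c*s + d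

noncomputable def ent0_33 (a b c d v t x s : K) : K :=
  a*a*a*c*v*v + a*a*a*c*x*x + a*a*c*c*v*v + a*a*c*c*x*x + a*a*a*d*v + a*a*a*d*x + a*a*b*c*v + a*a*b*c*x + a*a*c*d*v + a*a*c*d*x + a*b*c*c*v + a*b*c*c*x + a*a*v*v + a*a*v*t + a*a*v*x + a*a*v*s + a*a*t*x + a*a*x*s + c*c*v*v + c*c*v*t + c*c*v*x + c*c*t*x + a*b*v + a*d*x + a*d*s + b*c*s + c*d*v + a*a + a*c + b*b + b*d + c*c + d*d + v*v + v*x + v*s + t*t + t*x + t*s + x*x + s*s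

noncomputable def ent0_20 (a b c d v t x s : K) : K :=
  a*a*c*v*v*t + a*a*c*t*x*x + a*c*c*v*v*t + a*c*c*t*x*x + a*a*b*v*v + a*a*b*v*x + a*a*d*v*t + a*a*d*t*x + a*b*c*v*v + a*b*c*v*t + a*b*c*t*x + a*b*c*x*x + b*c*c*v*t + b*c*c*v*x + b*c*c*t*x + b*c*c*x*x + a*a*a*v + a*a*a*x + a*b*b*v + a*b*b*x + a*b*d*x + a*c*c*v + a*c*c*x + a*d*d*t + a*v*v*v + a*v*v*s + a*v*t*t + a*v*t*s + a*v*x*x + a*v*x*s + a*t*t*x + a*t*x*s + b*b*c*v + b*b*c*x + b*c*d*v + b*c*d*t + c*v*v*v + c*v*v*s + c*v*t*t + c*v*t*x + c*v*t*s + c*v*x*x + c*v*x*s + c*t*t*x + c*t*x*x + c*t*x*s + a*a*d + a*c*d + b*b*d + b*d*d + b*t*x + b*x*x + d*v*v + d*v*s + d*t*t + d*t*s + c*v + c*x + d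

lemma rot0_entries (a b c d v t x s : K)
    (h : ((matMi a b v t) * (matM c d x s) * (matMi a b v t)) * ((matMi c d x s) * (matM a b v t) * (matM a b v t)) =
      ((matM c d x s) * (matMi a b v t) * (matMi a b v t)) * ((matMi c d x s) * (matM a b v t) * (matMi c d x s))) :
    ent0_00 a b c d v t x s = 0 ∧
    ent0_01 a b c d v t x s = 0 ∧
    ent0_02 a b c d v t x s = 0 ∧
    ent0_10 a b c d v t x s = 0 ∧
    ent0_11 a b c d v t x s = 0 ∧
    ent0_12 a b c d v t x s = 0 ∧
    ent0_13 a b c d v t x s = 0 ∧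
    ent0_20 a b c d v t x s = 0 ∧
    ent0_21 a b c d v t x s = 0 ∧
    ent0_22 a b c d v t x s = 0 ∧
    ent0_23 a b c d v t x s = 0 ∧
    ent0_31 a b c d v t x s = 0 ∧
    ent0_32 a b c d v t x s = 0 ∧
    ent0_33 a b c d v t x s = 0 := by
  simp only [matM, matMi, mul_four, mul_zero, zero_mul, mul_one, one_mul, zero_add, add_zero] at h
  refine ⟨?_, ?_, ?_, ?_, ?_, ?_, ?_, ?_, ?_, ?_, ?_, ?_, ?_, ?_⟩
  · have h1 := congrFun (congrFun h 0) 0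
    clear h
    rw [ent0_00]
    simp only [Matrix.of_apply, Matrix.cons_val] at h1
    linear_combination (norm := skip) h1
    clear h1
    grind
  · have h1 := congrFun (congrFun h 0) 1
    clear h
    rw [ent0_01]
    simp only [Matrix.of_apply, Matrix.cons_val] at h1
    linear_combination (norm := skip) h1
    clear h1
    grind
  · have h1 := congrFun (congrFun h 0) 2
    clear h
    rw [ent0_02]
    simp only [Matrix.of_apply, Matrix.cons_val] at h1
    linear_combination (norm := skip) h1
    clear h1
    grind
  · have h1 := congrFun (congrFun h 1) 0
    clear h
    rw [ent0_10]
    simp only [Matrix.of_apply, Matrix.cons_val] at h1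
    linear_combination (norm := skip) h1
    clear h1
    grind
  · have h1 := congrFun (congrFun h 1) 1
    clear h
    rw [ent0_11]
    simp only [Matrix.of_apply, Matrix.cons_val] at h1
    linear_combination (norm := skip) h1
    clear h1
    grind
  · have h1 := congrFun (congrFun h 1) 2
    clear h
    rw [ent0_12]
    simp only [Matrix.of_apply, Matrix.cons_val] at h1
    linear_combination (norm := skip) h1
    clear h1
    grind
  · have h1 := congrFun (congrFun h 1) 3
    clear h
    rw [ent0_13]
    simp only [Matrix.of_apply, Matrix.cons_val] at h1
    linear_combination (norm := skip) h1
    clear h1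
    grind
  · have h1 := congrFun (congrFun h 2) 0
    clear h
    rw [ent0_20]
    simp only [Matrix.of_apply, Matrix.cons_val] at h1
    linear_combination (norm := skip) h1
    clear h1
    grind
  · have h1 := congrFun (congrFun h 2) 1
    clear h
    rw [ent0_21]
    simp only [Matrix.of_apply, Matrix.cons_val] at h1
    linear_combination (norm := skip) h1
    clear h1
    grind
  · have h1 := congrFun (congrFun h 2) 2
    clear h
    rw [ent0_22]
    simp only [Matrix.of_apply, Matrix.cons_val] at h1
    linear_combination (norm := skip) h1
    clear h1
    grind
  · have h1 := congrFun (congrFun h 2) 3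
    clear h
    rw [ent0_23]
    simp only [Matrix.of_apply, Matrix.cons_val] at h1
    linear_combination (norm := skip) h1
    clear h1
    grind
  · have h1 := congrFun (congrFun h 3) 1
    clear h
    rw [ent0_31]
    simp only [Matrix.of_apply, Matrix.cons_val] at h1
    linear_combination (norm := skip) h1
    clear h1
    grind
  · have h1 := congrFun (congrFun h 3) 2
    clear h
    rw [ent0_32]
    simp only [Matrix.of_apply, Matrix.cons_val] at h1
    linear_combination (norm := skip) h1
    clear h1
    grind
  · have h1 := congrFun (congrFun h 3) 3
    clear h
    rw [ent0_33]
    simp only [Matrix.of_apply, Matrix.cons_val] at h1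
    linear_combination (norm := skip) h1
    clear h1
    grind

lemma rot1_entries (a b c d v t x s : K)
    (h : ((matMi c d x s) * (matM a b v t) * (matM a b v t)) * ((matM c d x s) * (matMi a b v t) * (matM c d x s)) =
      ((matM a b v t) * (matMi c d x s) * (matM a b v t)) * ((matM c d x s) * (matMi a b v t) * (matMi a b v t))) :
    ent1_00 a b c d v t x s = 0 ∧
    ent1_01 a b c d v t x s = 0 ∧
    ent1_10 a b c d v t x s = 0 ∧
    ent1_11 a b c d v t x s = 0 ∧
    ent1_20 a b c d v t x s = 0 ∧
    ent1_21 a b c d v t x s = 0 ∧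
    ent1_23 a b c d v t x s = 0 := by
  simp only [matM, matMi, mul_four, mul_zero, zero_mul, mul_one, one_mul, zero_add, add_zero] at h
  refine ⟨?_, ?_, ?_, ?_, ?_, ?_, ?_⟩
  · have h1 := congrFun (congrFun h 0) 0
    clear h
    rw [ent1_00]
    simp only [Matrix.of_apply, Matrix.cons_val] at h1
    linear_combination (norm := skip) h1
    clear h1
    grind
  · have h1 := congrFun (congrFun h 0) 1
    clear h
    rw [ent1_01]
    simp only [Matrix.of_apply, Matrix.cons_val] at h1
    linear_combination (norm := skip) h1
    clear h1
    grind
  · have h1 := congrFun (congrFun h 1) 0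
    clear h
    rw [ent1_10]
    simp only [Matrix.of_apply, Matrix.cons_val] at h1
    linear_combination (norm := skip) h1
    clear h1
    grind
  · have h1 := congrFun (congrFun h 1) 1
    clear h
    rw [ent1_11]
    simp only [Matrix.of_apply, Matrix.cons_val] at h1
    linear_combination (norm := skip) h1
    clear h1
    grind
  · have h1 := congrFun (congrFun h 2) 0
    clear h
    rw [ent1_20]
    simp only [Matrix.of_apply, Matrix.cons_val] at h1
    linear_combination (norm := skip) h1
    clear h1
    grind
  · have h1 := congrFun (congrFun h 2) 1
    clear h
    rw [ent1_21]
    simp only [Matrix.of_apply, Matrix.cons_val] at h1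
    linear_combination (norm := skip) h1
    clear h1
    grind
  · have h1 := congrFun (congrFun h 2) 3
    clear h
    rw [ent1_23]
    simp only [Matrix.of_apply, Matrix.cons_val] at h1
    linear_combination (norm := skip) h1
    clear h1
    grind

lemma rot2_entries (a b c d v t x s : K)
    (h : ((matM a b v t) * (matM a b v t) * (matM c d x s)) * ((matMi a b v t) * (matM c d x s) * (matM a b v t)) =
      ((matM c d x s) * (matM a b v t) * (matMi c d x s)) * ((matM a b v t) * (matM c d x s) * (matMi a b v t))) :
    ent2_00 a b c d v t x s = 0 ∧
    ent2_20 a b c d v t x s = 0 ∧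
    ent2_21 a b c d v t x s = 0 ∧
    ent2_22 a b c d v t x s = 0 ∧
    ent2_23 a b c d v t x s = 0 ∧
    ent2_30 a b c d v t x s = 0 ∧
    ent2_31 a b c d v t x s = 0 ∧
    ent2_32 a b c d v t x s = 0 := by
  simp only [matM, matMi, mul_four, mul_zero, zero_mul, mul_one, one_mul, zero_add, add_zero] at h
  refine ⟨?_, ?_, ?_, ?_, ?_, ?_, ?_, ?_⟩
  · have h1 := congrFun (congrFun h 0) 0
    clear h
    rw [ent2_00]
    simp only [Matrix.of_apply, Matrix.cons_val] at h1
    linear_combination (norm := skip) h1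
    clear h1
    grind
  · have h1 := congrFun (congrFun h 2) 0
    clear h
    rw [ent2_20]
    simp only [Matrix.of_apply, Matrix.cons_val] at h1
    linear_combination (norm := skip) h1
    clear h1
    grind
  · have h1 := congrFun (congrFun h 2) 1
    clear h
    rw [ent2_21]
    simp only [Matrix.of_apply, Matrix.cons_val] at h1
    linear_combination (norm := skip) h1
    clear h1
    grind
  · have h1 := congrFun (congrFun h 2) 2
    clear h
    rw [ent2_22]
    simp only [Matrix.of_apply, Matrix.cons_val] at h1
    linear_combination (norm := skip) h1
    clear h1
    grind
  · have h1 := congrFun (congrFun h 2) 3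
    clear h
    rw [ent2_23]
    simp only [Matrix.of_apply, Matrix.cons_val] at h1
    linear_combination (norm := skip) h1
    clear h1
    grind
  · have h1 := congrFun (congrFun h 3) 0
    clear h
    rw [ent2_30]
    simp only [Matrix.of_apply, Matrix.cons_val] at h1
    linear_combination (norm := skip) h1
    clear h1
    grind
  · have h1 := congrFun (congrFun h 3) 1
    clear h
    rw [ent2_31]
    simp only [Matrix.of_apply, Matrix.cons_val] at h1
    linear_combination (norm := skip) h1
    clear h1
    grind
  · have h1 := congrFun (congrFun h 3) 2
    clear h
    rw [ent2_32]
    simp only [Matrix.of_apply, Matrix.cons_val] at h1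
    linear_combination (norm := skip) h1
    clear h1
    grind

lemma cert_trace (a b c d v t x s : K)
    (h_ent0_01 : ent0_01 a b c d v t x s = 0)
    (h_ent1_23 : ent1_23 a b c d v t x s = 0)
    (h_ent0_11 : ent0_11 a b c d v t x s = 0)
    (h_ent1_11 : ent1_11 a b c d v t x s = 0)
    (h_ent1_00 : ent1_00 a b c d v t x s = 0)
    (h_ent0_00 : ent0_00 a b c d v t x s = 0)
    (h_ent2_30 : ent2_30 a b c d v t x s = 0)
    (h_ent2_32 : ent2_32 a b c d v t x s = 0)
    (h_ent2_31 : ent2_31 a b c d v t x s = 0)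
    (h_ent0_22 : ent0_22 a b c d v t x s = 0)
    (h_ent1_10 : ent1_10 a b c d v t x s = 0)
    (h_ent0_23 : ent0_23 a b c d v t x s = 0)
    (h_ent2_21 : ent2_21 a b c d v t x s = 0)
    (h_ent1_21 : ent1_21 a b c d v t x s = 0)
    (h_ent0_12 : ent0_12 a b c d v t x s = 0)
    (h_ent0_21 : ent0_21 a b c d v t x s = 0)
    (h_ent2_20 : ent2_20 a b c d v t x s = 0)
    (h_ent0_02 : ent0_02 a b c d v t x s = 0)
    (h_ent1_20 : ent1_20 a b c d v t x s = 0)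
    (h_ent0_13 : ent0_13 a b c d v t x s = 0)
    (h_ent2_00 : ent2_00 a b c d v t x s = 0) :
    x * c * (a * (t + s) + (a + c) * (a ^ 2 * (x + v) + x)) = 0 := by
  have key : x * c * (a * (t + s) + (a + c) * (a ^ 2 * (x + v) + x)) =
      (b*c*c*v + b*c*c*x + a*c*c + b*b*c + b*c*d + c*v*v + c*v*x + c*t*x + b*v + b*x + d*t + a + c) * ent0_01 a b c d v t x s +
      (a*b*c*v + a*b*c*x + a*a*c + a*b*b + a*v*t + a*t*x + b*b*c + c*v*v + c*v*x + b*t + b*s + d*v + c) * ent1_23 a b c d v t x s +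
      (a*d*v + a*d*t + b*c*t + b*c*x + a*a + a*c + b*b + b*d + v*v + v*s + t*t + t*x + t*s + 1) * ent0_11 a b c d v t x s +
      (a*c + v*t + 1) * ent1_11 a b c d v t x s +
      ent1_00 a b c d v t x s +
      (a*a*v*v + a*a*v*x + a*b*c*d + a*c*v*v + a*c*v*x + b*b*c*c + b*c*v + b*c*t + b*c*s + a*a + a*c + v*v + v*t + v*x) * ent0_00 a b c d v t x s +
      (a*c*t + a*b + a*d + v + t) * ent2_30 a b c d v t x s +
      (a*v*t + a) * ent2_32 a b c d v t x s +
      (d) * ent2_31 a b c d v t x s +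
      (a*c + v*x + 1) * ent0_22 a b c d v t x s +
      (a*v*t + b*t + a + c) * ent1_10 a b c d v t x s +
      (a*v*x + b*x + a + c) * ent0_23 a b c d v t x s +
      (t + x) * ent2_21 a b c d v t x s +
      (a*a*v + a*a*x + a*b + a*d) * ent1_21 a b c d v t x s +
      (a*a*v + a*a*x + a*c*v + a*c*x + a*b + a*d) * ent0_12 a b c d v t x s +
      (t + x) * ent0_21 a b c d v t x s +
      (c*t + b + d) * ent2_20 a b c d v t x s +
      (a*t) * ent0_02 a b c d v t x s +
      (a*x + b) * ent1_20 a b c d v t x s +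
      (a*x + b) * ent0_13 a b c d v t x s +
      ent2_00 a b c d v t x s := by
    clear h_ent0_01 h_ent1_23 h_ent0_11 h_ent1_11 h_ent1_00 h_ent0_00 h_ent2_30 h_ent2_32 h_ent2_31 h_ent0_22 h_ent1_10 h_ent0_23 h_ent2_21 h_ent1_21 h_ent0_12 h_ent0_21 h_ent2_20 h_ent0_02 h_ent1_20 h_ent0_13 h_ent2_00
    simp only [ent0_01, ent1_23, ent0_11, ent1_11, ent1_00, ent0_00, ent2_30, ent2_32, ent2_31, ent0_22, ent1_10, ent0_23, ent2_21, ent1_21, ent0_12, ent0_21, ent2_20, ent0_02, ent1_20, ent0_13, ent2_00]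
    grind
  rw [key, h_ent0_01, h_ent1_23, h_ent0_11, h_ent1_11, h_ent1_00, h_ent0_00, h_ent2_30, h_ent2_32, h_ent2_31, h_ent0_22, h_ent1_10, h_ent0_23, h_ent2_21, h_ent1_21, h_ent0_12, h_ent0_21, h_ent2_20, h_ent0_02, h_ent1_20, h_ent0_13, h_ent2_00]
  simp

noncomputable def red0_00 (a b c d t u m : K) : K :=
  a*d*m + b*c*m + c*t*u + d*u

lemma red0_00_zero (a b c d t u m : K) (ha : a ≠ 0) (hc : c ≠ 0) (hm : m ≠ 0)
    (h : ent0_00 a b c d (u + a * m) t (a * m) (t + (a + c) * (a * u + m)) = 0) : red0_00 a b c d t u m = 0 := by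
  have key : ent0_00 a b c d (u + a * m) t (a * m) (t + (a + c) * (a * u + m)) = (a) * red0_00 a b c d t u m := by
    clear h ha hc hm
    simp only [ent0_00, red0_00]
    grind
  rw [key] at h
  simpa [ha, hc, hm] using h

noncomputable def red0_01 (a b c d t u m : K) : K :=
  a*a*b*m + a*a*t*u + a*a*m*m + a*b*c*m + a*c*t*u + a*c*m*m + a*b*u + a*d*t + a*t*m + b*c*t + c*t*m + c*u*m + a*a + a*c + b*b + b*d + t*u + u*u + 1

lemma red0_01_zero (a b c d t u m : K) (ha : a ≠ 0) (hc : c ≠ 0) (hm : m ≠ 0)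
    (h : ent0_01 a b c d (u + a * m) t (a * m) (t + (a + c) * (a * u + m)) = 0) : red0_01 a b c d t u m = 0 := by
  have key : ent0_01 a b c d (u + a * m) t (a * m) (t + (a + c) * (a * u + m)) = (a) * red0_01 a b c d t u m := by
    clear h ha hc hm
    simp only [ent0_01, red0_01]
    grind
  rw [key] at h
  simpa [ha, hc, hm] using h

noncomputable def red0_32 (a b c d t u m : K) : K :=
  a*a*a*t*u + a*a*a*u*u + a*a*b*c*m + a*a*c*u*u + a*a*c*m*m + a*b*c*c*m + a*c*c*m*m + a*a*b*u + a*a*d*t + a*a*u*m + a*b*c*t + a*b*c*u + a*c*d*u + a*c*t*m + a*c*u*m + c*c*u*m + a*a*c + a*b*d + a*c*c + a*d*d + a*t*u + b*c*m + c*d*m + d*t + d*u + c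

lemma red0_32_zero (a b c d t u m : K) (ha : a ≠ 0) (hc : c ≠ 0) (hm : m ≠ 0)
    (h : ent0_32 a b c d (u + a * m) t (a * m) (t + (a + c) * (a * u + m)) = 0) : red0_32 a b c d t u m = 0 := by
  have key : ent0_32 a b c d (u + a * m) t (a * m) (t + (a + c) * (a * u + m)) = red0_32 a b c d t u m := by
    clear h ha hc hm
    simp only [ent0_32, red0_32]
    grind
  rw [key] at h
  simpa [ha, hc, hm] using h

noncomputable def red2_21 (a b c d t u m : K) : K :=
  a*a*a*b*b*m + a*a*a*t*u*m + a*a*a*m*m*m + a*a*b*c*t*u + a*a*c*t*u*m + a*b*c*c*t*u + a*a*t*u*u + a*a*u*m*m + a*c*t*u*u + b*b*c*c*u + a*a*a*b + a*a*a*m + a*a*c*m + a*b*b*b + a*b*b*m + a*b*t*t + a*u*u*m + c*c*c*m + a*a*t + a*c*t + a*c*u + b*b*t + b*b*u + c*c*t + u*u*u + a*d + a*m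

lemma red2_21_zero (a b c d t u m : K) (ha : a ≠ 0) (hc : c ≠ 0) (hm : m ≠ 0)
    (h : ent2_21 a b c d (u + a * m) t (a * m) (t + (a + c) * (a * u + m)) = 0) : red2_21 a b c d t u m = 0 := by
  have key : ent2_21 a b c d (u + a * m) t (a * m) (t + (a + c) * (a * u + m)) = red2_21 a b c d t u m := by
    clear h ha hc hm
    simp only [ent2_21, red2_21]
    grind
  rw [key] at h
  simpa [ha, hc, hm] using h

noncomputable def red2_23 (a b c d t u m : K) : K :=
  a*a*a*b*m + a*a*a*u*u + a*b*c*c*m + a*c*c*u*u + b*c*c*c*m + c*c*c*m*m + a*a*t*m + a*c*d*t + a*c*d*u + a*c*t*m + b*c*c*t + b*c*c*u + c*c*d*u + c*c*t*m + a*a*a + a*b*b + a*b*m + a*c*c + a*d*d + a*t*t + a*t*u + a*u*u + c*c*c + c*d*d + c*d*m + c*t*u + b*t + d*u + a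

lemma red2_23_zero (a b c d t u m : K) (ha : a ≠ 0) (hc : c ≠ 0) (hm : m ≠ 0)
    (h : ent2_23 a b c d (u + a * m) t (a * m) (t + (a + c) * (a * u + m)) = 0) : red2_23 a b c d t u m = 0 := by
  have key : ent2_23 a b c d (u + a * m) t (a * m) (t + (a + c) * (a * u + m)) = red2_23 a b c d t u m := by
    clear h ha hc hm
    simp only [ent2_23, red2_23]
    grind
  rw [key] at h
  simpa [ha, hc, hm] using h

noncomputable def red0_21 (a b c d t u m : K) : K :=
  a*a*a*b*u*u + a*a*b*c*u*u + a*a*c*u*u*m + a*c*c*u*u*m + a*a*b*u*m + a*a*d*u*m + a*a*u*m*m + a*b*b*c*u + a*b*c*d*u + a*b*c*u*m + a*c*u*u*u + b*b*c*c*u + b*c*c*u*m + c*c*u*u*u + a*b*b*m + a*b*d*d + a*b*d*m + a*d*d*m + a*d*u*u + a*u*u*m + b*b*c*d + b*c*d*m + a*a*t + a*a*u + a*c*t + c*c*u + d*d*u + a*b + a*d + a*m + c*d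

lemma red0_21_zero (a b c d t u m : K) (ha : a ≠ 0) (hc : c ≠ 0) (hm : m ≠ 0)
    (h : ent0_21 a b c d (u + a * m) t (a * m) (t + (a + c) * (a * u + m)) = 0) : red0_21 a b c d t u m = 0 := by
  have key : ent0_21 a b c d (u + a * m) t (a * m) (t + (a + c) * (a * u + m)) = red0_21 a b c d t u m := by
    clear h ha hc hm
    simp only [ent0_21, red0_21]
    grind
  rw [key] at h
  simpa [ha, hc, hm] using h

noncomputable def red0_11 (a b c d t u m : K) : K :=
  a*a*a*t*m + a*a*b*c*u + a*a*c*t*m + a*c*c*u*m + a*a*b*m + a*b*c*d + a*b*c*m + a*c*d*m + b*b*c*c + b*c*c*m + c*c*u*u + a*b*t + a*d*t + c*d*u + a*a + a*c + c*c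

lemma red0_11_zero (a b c d t u m : K) (ha : a ≠ 0) (hc : c ≠ 0) (hm : m ≠ 0)
    (h : ent0_11 a b c d (u + a * m) t (a * m) (t + (a + c) * (a * u + m)) = 0) : red0_11 a b c d t u m = 0 := by
  have key : ent0_11 a b c d (u + a * m) t (a * m) (t + (a + c) * (a * u + m)) = red0_11 a b c d t u m := by
    clear h ha hc hm
    simp only [ent0_11, red0_11]
    grind
  rw [key] at h
  simpa [ha, hc, hm] using h

noncomputable def red0_22 (a b c d t u m : K) : K :=
  a*a*a*a*u*u + a*a*a*c*u*u + a*a*a*t*m + a*a*a*u*m + a*a*b*c*u + a*a*c*d*u + a*a*c*t*m + a*b*c*c*u + a*a*d*d + a*a*m*m + a*b*c*d + a*c*d*m + a*c*t*u + c*c*t*u + a*b*t + a*b*u + a*u*m + b*c*t + b*b + b*d + d*d + u*u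

lemma red0_22_zero (a b c d t u m : K) (ha : a ≠ 0) (hc : c ≠ 0) (hm : m ≠ 0)
    (h : ent0_22 a b c d (u + a * m) t (a * m) (t + (a + c) * (a * u + m)) = 0) : red0_22 a b c d t u m = 0 := by
  have key : ent0_22 a b c d (u + a * m) t (a * m) (t + (a + c) * (a * u + m)) = red0_22 a b c d t u m := by
    clear h ha hc hm
    simp only [ent0_22, red0_22]
    grind
  rw [key] at h
  simpa [ha, hc, hm] using h

noncomputable def red2_32 (a b c d t u m : K) : K :=
  a*a*a*c*u*m + a*a*c*c*u*m + a*a*a*b*m + a*a*a*m*m + a*a*c*t*u + a*a*c*u*u + a*a*c*m*m + a*c*c*t*u + a*c*c*u*u + a*c*c*m*m + a*a*t*m + a*a*u*m + a*b*c*u + a*c*t*m + c*c*u*m + a*a*a + a*b*b + a*t*t + a*u*u + b*c*m + c*d*m + d*t + d*u + c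

lemma red2_32_zero (a b c d t u m : K) (ha : a ≠ 0) (hc : c ≠ 0) (hm : m ≠ 0)
    (h : ent2_32 a b c d (u + a * m) t (a * m) (t + (a + c) * (a * u + m)) = 0) : red2_32 a b c d t u m = 0 := by
  have key : ent2_32 a b c d (u + a * m) t (a * m) (t + (a + c) * (a * u + m)) = red2_32 a b c d t u m := by
    clear h ha hc hm
    simp only [ent2_32, red2_32]
    grind
  rw [key] at h
  simpa [ha, hc, hm] using h

noncomputable def red0_10 (a b c d t u m : K) : K :=
  a*a*a*c*u*m + a*a*c*c*u*m + a*a*a*m*m + a*a*b*c*m + a*a*c*t*u + a*a*c*u*u + a*b*c*c*m + a*c*c*u*u + a*c*c*m*m + a*a*t*m + a*a*u*m + a*b*c*u + a*c*d*t + a*c*u*m + b*c*c*t + c*c*t*m + c*c*u*m + a*a*c + a*c*c + a*t*u + b*b*c + b*c*d + c*t*u + c*u*u + c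

lemma red0_10_zero (a b c d t u m : K) (ha : a ≠ 0) (hc : c ≠ 0) (hm : m ≠ 0)
    (h : ent0_10 a b c d (u + a * m) t (a * m) (t + (a + c) * (a * u + m)) = 0) : red0_10 a b c d t u m = 0 := by
  have key : ent0_10 a b c d (u + a * m) t (a * m) (t + (a + c) * (a * u + m)) = red0_10 a b c d t u m := by
    clear h ha hc hm
    simp only [ent0_10, red0_10]
    grind
  rw [key] at h
  simpa [ha, hc, hm] using h

noncomputable def red1_01 (a b c d t u m : K) : K :=
  a*a*a*a*u*m + a*a*a*c*u*m + a*a*a*d*m + a*a*a*t*u + a*a*c*t*u + a*b*c*c*m + a*a*b*u + a*a*d*t + a*a*d*u + a*a*u*m + a*b*c*t + a*b*c*u + a*c*d*u + a*c*u*m + c*c*u*m + a*a*c + a*b*d + a*c*c + a*d*d + a*t*u + b*c*m + c*d*m + d*t + d*u + c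

lemma red1_01_zero (a b c d t u m : K) (ha : a ≠ 0) (hc : c ≠ 0) (hm : m ≠ 0)
    (h : ent1_01 a b c d (u + a * m) t (a * m) (t + (a + c) * (a * u + m)) = 0) : red1_01 a b c d t u m = 0 := by
  have key : ent1_01 a b c d (u + a * m) t (a * m) (t + (a + c) * (a * u + m)) = red1_01 a b c d t u m := by
    clear h ha hc hm
    simp only [ent1_01, red1_01]
    grind
  rw [key] at h
  simpa [ha, hc, hm] using h

noncomputable def red2_31 (a b c d t u m : K) : K :=
  a*a*a*u*m*m + a*a*b*c*u*m + a*a*c*u*m*m + a*b*c*c*u*m + a*a*b*b*m + a*a*b*m*m + a*a*t*u*m + a*b*c*t*u + a*b*c*u*u + a*c*t*u*m + b*c*c*t*u + b*c*c*u*u + a*b*t*m + a*t*u*u + a*u*u*u + b*b*c*u + c*t*u*u + c*u*u*u + a*a*b + a*c*m + b*b*b + b*t*t + b*t*u + b*u*u + c*c*m + a*u + c*t + c*u + d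

lemma red2_31_zero (a b c d t u m : K) (ha : a ≠ 0) (hc : c ≠ 0) (hm : m ≠ 0)
    (h : ent2_31 a b c d (u + a * m) t (a * m) (t + (a + c) * (a * u + m)) = 0) : red2_31 a b c d t u m = 0 := by
  have key : ent2_31 a b c d (u + a * m) t (a * m) (t + (a + c) * (a * u + m)) = red2_31 a b c d t u m := by
    clear h ha hc hm
    simp only [ent2_31, red2_31]
    grind
  rw [key] at h
  simpa [ha, hc, hm] using h

noncomputable def red2_22 (a b c d t u m : K) : K :=
  a*a*a*a*b*m + a*a*a*a*m*m + a*a*a*c*t*u + a*a*a*c*m*m + a*a*c*c*t*u + a*c*c*c*m*m + a*a*a*t*m + a*a*c*t*m + a*b*c*c*u + a*c*c*t*m + a*c*c*u*m + c*c*c*u*m + a*a*a*a + a*a*b*b + a*a*b*m + a*a*d*m + a*a*t*t + a*a*u*u + a*a*m*m + a*b*c*m + b*c*c*m + c*c*d*m + c*c*t*u + a*b*u + a*u*m + b*c*t + c*d*t + c*d*u + a*a + b*b + b*d + c*c + d*d + u*u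

lemma red2_22_zero (a b c d t u m : K) (ha : a ≠ 0) (hc : c ≠ 0) (hm : m ≠ 0)
    (h : ent2_22 a b c d (u + a * m) t (a * m) (t + (a + c) * (a * u + m)) = 0) : red2_22 a b c d t u m = 0 := by
  have key : ent2_22 a b c d (u + a * m) t (a * m) (t + (a + c) * (a * u + m)) = red2_22 a b c d t u m := by
    clear h ha hc hm
    simp only [ent2_22, red2_22]
    grind
  rw [key] at h
  simpa [ha, hc, hm] using h

noncomputable def red0_31 (a b c d t u m : K) : K :=
  a*a*c*u*m*m + a*c*c*u*m*m + a*a*b*t*u + a*a*b*u*u + a*a*u*u*m + a*b*b*c*m + a*b*c*u*u + a*c*d*m*m + a*c*t*u*m + b*b*c*c*m + b*c*c*m*m + c*c*u*u*m + a*b*b*u + a*b*d*t + a*d*t*m + a*d*u*m + a*u*u*u + b*b*c*t + b*b*c*u + b*c*d*u + b*c*t*m + c*d*u*m + c*t*u*u + c*u*u*u + a*b*c + a*c*m + b*b*d + b*c*c + b*d*d + c*c*m + d*t*u + d*u*u + a*u + c*t + d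

lemma red0_31_zero (a b c d t u m : K) (ha : a ≠ 0) (hc : c ≠ 0) (hm : m ≠ 0)
    (h : ent0_31 a b c d (u + a * m) t (a * m) (t + (a + c) * (a * u + m)) = 0) : red0_31 a b c d t u m = 0 := by
  have key : ent0_31 a b c d (u + a * m) t (a * m) (t + (a + c) * (a * u + m)) = red0_31 a b c d t u m := by
    clear h ha hc hm
    simp only [ent0_31, red0_31]
    grind
  rw [key] at h
  simpa [ha, hc, hm] using h

noncomputable def red1_20 (a b c d t u m : K) : K :=
  a*a*a*b*u*m + a*a*a*u*m*m + a*a*b*c*u*m + a*a*c*d*u*m + a*a*c*t*u*u + a*b*c*c*u*m + a*c*c*d*u*m + a*c*c*t*u*u + a*a*b*b*m + a*a*b*d*m + a*a*b*m*m + a*a*d*m*m + a*a*t*u*m + a*a*u*u*m + a*b*c*t*u + a*b*c*u*u + a*c*d*t*u + a*c*d*u*u + a*c*u*u*m + b*c*c*t*u + c*c*d*t*u + c*c*d*u*u + a*a*a*u + a*b*b*u + a*t*t*u + a*t*u*u + b*b*c*u + b*c*d*u + c*u*u*u + a*a*b + a*a*d + a*a*m + a*c*d + b*b*b + b*b*d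 + b*c*c + b*t*t + b*t*u + b*u*u + c*c*m + d*t*t + d*u*u + a*t + a*u + b

lemma red1_20_zero (a b c d t u m : K) (ha : a ≠ 0) (hc : c ≠ 0) (hm : m ≠ 0)
    (h : ent1_20 a b c d (u + a * m) t (a * m) (t + (a + c) * (a * u + m)) = 0) : red1_20 a b c d t u m = 0 := by
  have key : ent1_20 a b c d (u + a * m) t (a * m) (t + (a + c) * (a * u + m)) = red1_20 a b c d t u m := by
    clear h ha hc hm
    simp only [ent1_20, red1_20]
    grind
  rw [key] at h
  simpa [ha, hc, hm] using h

noncomputable def red0_33 (a b c d t u m : K) : K :=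
  a*a*a*u*m + a*c*c*u*m + a*a*b*m + a*a*t*u + a*a*m*m + a*b*c*m + a*c*t*u + a*c*u*u + a*c*m*m + b*c*c*m + c*c*t*u + c*c*u*u + c*c*m*m + a*b*u + a*d*t + a*t*m + b*c*t + c*d*u + c*t*m + c*u*m + a*a + a*c + b*b + b*d + c*c + d*d + t*t + t*u + u*u

lemma red0_33_zero (a b c d t u m : K) (ha : a ≠ 0) (hc : c ≠ 0) (hm : m ≠ 0)
    (h : ent0_33 a b c d (u + a * m) t (a * m) (t + (a + c) * (a * u + m)) = 0) : red0_33 a b c d t u m = 0 := by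
  have key : ent0_33 a b c d (u + a * m) t (a * m) (t + (a + c) * (a * u + m)) = red0_33 a b c d t u m := by
    clear h ha hc hm
    simp only [ent0_33, red0_33]
    grind
  rw [key] at h
  simpa [ha, hc, hm] using h

noncomputable def red2_20 (a b c d t u m : K) : K :=
  a*a*a*a*t*u*m + a*a*c*c*t*u*m + a*a*a*t*u*u + a*a*a*u*m*m + a*a*b*c*u*m + a*a*c*t*t*u + a*a*c*u*m*m + a*b*c*c*u*m + a*c*c*t*t*u + a*c*c*t*u*u + a*a*b*b*m + a*a*b*m*m + a*a*t*u*m + a*b*c*t*u + a*b*c*u*u + a*c*t*u*m + b*c*c*t*u + b*c*c*u*u + a*b*t*m + a*t*t*t + a*t*u*u + a*u*u*u + b*b*c*u + c*t*u*u + c*u*u*u + a*a*b + a*c*m + b*b*b + b*t*t + b*t*u + b*u*u + c*c*m + a*t + a*u + c*t + c*u + d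

lemma red2_20_zero (a b c d t u m : K) (ha : a ≠ 0) (hc : c ≠ 0) (hm : m ≠ 0)
    (h : ent2_20 a b c d (u + a * m) t (a * m) (t + (a + c) * (a * u + m)) = 0) : red2_20 a b c d t u m = 0 := by
  have key : ent2_20 a b c d (u + a * m) t (a * m) (t + (a + c) * (a * u + m)) = red2_20 a b c d t u m := by
    clear h ha hc hm
    simp only [ent2_20, red2_20]
    grind
  rw [key] at h
  simpa [ha, hc, hm] using h

noncomputable def red1_21 (a b c d t u m : K) : K :=
  a*a*a*c*u + a*a*c*c*u + a*a*d*u*m + a*a*t*u*u + a*a*u*m*m + a*b*c*u*m + a*c*d*u*m + a*c*t*u*u + a*a*a*m + a*a*c*d + a*a*c*m + a*b*c*c + a*b*u*u + a*d*t*u + a*d*u*u + b*c*t*u + c*d*t*u + c*d*u*u + a*c*u + b*b*t + b*b*u + b*d*t + c*c*u + u*u*u + a*b + a*m + b*c + c*d + u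

lemma red1_21_zero (a b c d t u m : K) (ha : a ≠ 0) (hc : c ≠ 0) (hm : m ≠ 0)
    (h : ent1_21 a b c d (u + a * m) t (a * m) (t + (a + c) * (a * u + m)) = 0) : red1_21 a b c d t u m = 0 := by
  have key : ent1_21 a b c d (u + a * m) t (a * m) (t + (a + c) * (a * u + m)) = red1_21 a b c d t u m := by
    clear h ha hc hm
    simp only [ent1_21, red1_21]
    grind
  rw [key] at h
  simpa [ha, hc, hm] using h

noncomputable def red0_20 (a b c d t u m : K) : K :=
  a*a*a*a*u*u*m + a*a*c*c*u*u*m + a*a*a*b*u*m + a*a*a*d*u*m + a*a*a*t*u*u + a*a*a*u*u*u + a*a*a*u*m*m + a*a*c*d*u*m + a*a*c*t*u*u + a*b*c*c*u*m + a*c*c*u*u*u + a*c*c*u*m*m + a*a*b*d*m + a*a*b*u*u + a*a*b*m*m + a*a*d*u*u + a*b*c*d*m + a*b*c*t*u + a*b*c*u*u + a*c*d*t*u + a*c*d*u*u + a*c*d*m*m + a*c*u*u*m + b*c*c*t*u + c*c*t*u*m + c*c*u*u*m + a*a*a*u + a*b*b*u + a*b*t*m + a*c*c*u + a*d*d*t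 + a*d*u*m + a*t*u*u + a*u*u*u + b*b*c*u + b*c*d*t + b*c*d*u + c*d*t*m + c*d*u*m + c*t*u*u + c*u*u*u + a*a*d + a*c*d + b*b*d + b*d*d + d*t*u + d*u*u + c*u + d

lemma red0_20_zero (a b c d t u m : K) (ha : a ≠ 0) (hc : c ≠ 0) (hm : m ≠ 0)
    (h : ent0_20 a b c d (u + a * m) t (a * m) (t + (a + c) * (a * u + m)) = 0) : red0_20 a b c d t u m = 0 := by
  have key : ent0_20 a b c d (u + a * m) t (a * m) (t + (a + c) * (a * u + m)) = red0_20 a b c d t u m := by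
    clear h ha hc hm
    simp only [ent0_20, red0_20]
    grind
  rw [key] at h
  simpa [ha, hc, hm] using h

noncomputable def q3P (a b c d t u m : K) : K :=
  a*a*c*t*u + a*c*u*m + c*c*t*m + c*c*u*m + a*t*t + c*t*t + c*t*u + a + c

noncomputable def bP (a b c d t u m : K) : K :=
  a*t*t*m + c*t*t*m + a*c*u + c*c*u + t*t*t + a*m + c*m + t

noncomputable def g3P (a b c d t u m : K) : K :=
  a*b*c*m + a*c*t*u + a*c*m*m + a*d*t + a*u*m + b*c*t + a*c + b*d + t*t + t*u + 1

noncomputable def q1P (a b c d t u m : K) : K :=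
  a*a*m*m + a*c*t*u + c*c*m*m + a*t*m + a*u*m + c*u*m + t*t + t*u + 1

noncomputable def q2P (a b c d t u m : K) : K :=
  a*a*t*t + a*a*t*u + a*t*m + a*u*m + c*u*m + a*a + c*c + t*u + 1

noncomputable def gbP (a b c d t u m : K) : K :=
  a*a*b*m + a*a*t*u + a*c*t*u + c*c*m*m + a*b*u + c*t*m + a*a + b*b + t*u + u*u + 1

noncomputable def gdP (a b c d t u m : K) : K :=
  a*a*u*u + a*c*t*u + a*c*u*u + b*c*c*m + c*c*m*m + c*d*u + c*c + d*d

lemma q3P_zero (a b c d t u m : K) (ha : a ≠ 0) (hc : c ≠ 0) (hm : m ≠ 0)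
    (h_red0_00 : red0_00 a b c d t u m = 0)
    (h_red0_01 : red0_01 a b c d t u m = 0)
    (h_red0_32 : red0_32 a b c d t u m = 0)
    (h_red2_21 : red2_21 a b c d t u m = 0)
    (h_red2_23 : red2_23 a b c d t u m = 0)
    (h_red0_21 : red0_21 a b c d t u m = 0)
    (h_red0_11 : red0_11 a b c d t u m = 0)
    (h_red0_22 : red0_22 a b c d t u m = 0)
    (h_red2_32 : red2_32 a b c d t u m = 0)
    (h_red0_10 : red0_10 a b c d t u m = 0)
    (h_red1_01 : red1_01 a b c d t u m = 0)
    (h_red2_31 : red2_31 a b c d t u m = 0)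
    (h_red2_22 : red2_22 a b c d t u m = 0)
    (h_red0_31 : red0_31 a b c d t u m = 0)
    (h_red1_20 : red1_20 a b c d t u m = 0) :
    q3P a b c d t u m = 0 := by
  have key : (a*a*m) * q3P a b c d t u m =
      (a*a*a*u + a*a*c*t + a*c*c*t + a*c*c*u + a*a*d + a*a*m + a*c*m + a*u) * red0_00 a b c d t u m +
      (a*a*c*m + a*a*u + a*c*t + a*c*u + c*c*t + a*b + b*c) * red0_01 a b c d t u m +
      (a*a*m + c*t + d) * red0_32 a b c d t u m +
      red2_21 a b c d t u m +
      (b) * red2_23 a b c d t u m +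
      (a*c + c*c + 1) * red0_21 a b c d t u m +
      (a*a*u + c*c*u + a*d + a*m + c*d) * red0_11 a b c d t u m +
      (a*m + t) * red0_22 a b c d t u m +
      (a*t + b) * red2_32 a b c d t u m +
      (c*t + b) * red0_10 a b c d t u m +
      (b + d) * red1_01 a b c d t u m +
      (a) * red2_31 a b c d t u m +
      (t + u) * red2_22 a b c d t u m +
      (a + c) * red0_31 a b c d t u m +
      (a) * red1_20 a b c d t u m := by
    clear h_red0_00 h_red0_01 h_red0_32 h_red2_21 h_red2_23 h_red0_21 h_red0_11 h_red0_22 h_red2_32 h_red0_10 h_red1_01 h_red2_31 h_red2_22 h_red0_31 h_red1_20 ha hc hm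
    simp only [q3P, red0_00, red0_01, red0_32, red2_21, red2_23, red0_21, red0_11, red0_22, red2_32, red0_10, red1_01, red2_31, red2_22, red0_31, red1_20]
    grind
  rw [h_red0_00, h_red0_01, h_red0_32, h_red2_21, h_red2_23, h_red0_21, h_red0_11, h_red0_22, h_red2_32, h_red0_10, h_red1_01, h_red2_31, h_red2_22, h_red0_31, h_red1_20] at key
  simpa [ha, hc, hm] using key

lemma bP_zero (a b c d t u m : K) (ha : a ≠ 0) (hc : c ≠ 0) (hm : m ≠ 0)
    (h_red0_00 : red0_00 a b c d t u m = 0)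
    (h_red0_33 : red0_33 a b c d t u m = 0)
    (h_red0_31 : red0_31 a b c d t u m = 0)
    (h_q3P : q3P a b c d t u m = 0)
    (h_red0_01 : red0_01 a b c d t u m = 0)
    (h_red1_01 : red1_01 a b c d t u m = 0)
    (h_red0_32 : red0_32 a b c d t u m = 0)
    (h_red2_20 : red2_20 a b c d t u m = 0) :
    bP a b c d t u m = 0 := by
  have key : (a) * bP a b c d t u m =
      (a*a*t + a*a*u + a*c*t + a*c*u + a*b + a*d) * red0_00 a b c d t u m +
      (b) * red0_33 a b c d t u m +
      red0_31 a b c d t u m +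
      (a*m) * q3P a b c d t u m +
      (a*c*m) * red0_01 a b c d t u m +
      (u) * red1_01 a b c d t u m +
      (a*m) * red0_32 a b c d t u m +
      red2_20 a b c d t u m := by
    clear h_red0_00 h_red0_33 h_red0_31 h_q3P h_red0_01 h_red1_01 h_red0_32 h_red2_20 ha hc hm
    simp only [bP, red0_00, red0_33, red0_31, q3P, red0_01, red1_01, red0_32, red2_20]
    grind
  rw [h_red0_00, h_red0_33, h_red0_31, h_q3P, h_red0_01, h_red1_01, h_red0_32, h_red2_20] at key
  simpa [ha, hc, hm] using key

lemma g3P_zero (a b c d t u m : K) (ha : a ≠ 0) (hc : c ≠ 0) (hm : m ≠ 0)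
    (h_red0_00 : red0_00 a b c d t u m = 0)
    (h_bP : bP a b c d t u m = 0)
    (h_red0_01 : red0_01 a b c d t u m = 0)
    (h_q3P : q3P a b c d t u m = 0)
    (h_red0_11 : red0_11 a b c d t u m = 0)
    (h_red0_32 : red0_32 a b c d t u m = 0)
    (h_red1_21 : red1_21 a b c d t u m = 0)
    (h_red2_23 : red2_23 a b c d t u m = 0)
    (h_red2_31 : red2_31 a b c d t u m = 0)
    (h_red0_31 : red0_31 a b c d t u m = 0)
    (h_red0_22 : red0_22 a b c d t u m = 0)
    (h_red2_32 : red2_32 a b c d t u m = 0)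
    (h_red0_10 : red0_10 a b c d t u m = 0)
    (h_red1_01 : red1_01 a b c d t u m = 0)
    (h_red2_21 : red2_21 a b c d t u m = 0)
    (h_red0_21 : red0_21 a b c d t u m = 0)
    (h_red2_22 : red2_22 a b c d t u m = 0)
    (h_red0_20 : red0_20 a b c d t u m = 0)
    (h_red0_33 : red0_33 a b c d t u m = 0) :
    g3P a b c d t u m = 0 := by
  have key : (c*c*m) * g3P a b c d t u m =
      (a*a*a*a*u + a*a*c*c*u + a*a*a*d + a*a*a*m + a*a*b*c + a*b*c*c + a*c*c*m + a*c*t + a*c*u + c*c*u + a*b + a*m + b*c + c*d) * red0_00 a b c d t u m +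
      (c) * bP a b c d t u m +
      (a*a*a*u + a*a*m + b*c*c + c*c*m + c*t + d) * red0_01 a b c d t u m +
      (a*a*u + c*c*u + c*m + t) * q3P a b c d t u m +
      (a*u + c*t + b + d) * red0_11 a b c d t u m +
      (a*a*u + c*c*u + a*d + b*c + c*d + c*m + t) * red0_32 a b c d t u m +
      (a + c) * red1_21 a b c d t u m +
      (a*a*u + a*c*u + a*b + a*d + a*m + b*c + c*m + t + u) * red2_23 a b c d t u m +
      red2_31 a b c d t u m +
      (c*c + 1) * red0_31 a b c d t u m +
      (c*t + d) * red0_22 a b c d t u m +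
      (a*m + u) * red2_32 a b c d t u m +
      (a*d + c*m + t + u) * red0_10 a b c d t u m +
      (a*d + a*m + t + u) * red1_01 a b c d t u m +
      (c) * red2_21 a b c d t u m +
      (a + c) * red0_21 a b c d t u m +
      (b + d) * red2_22 a b c d t u m +
      red0_20 a b c d t u m +
      (c*c*m) * red0_33 a b c d t u m := by
    clear h_red0_00 h_bP h_red0_01 h_q3P h_red0_11 h_red0_32 h_red1_21 h_red2_23 h_red2_31 h_red0_31 h_red0_22 h_red2_32 h_red0_10 h_red1_01 h_red2_21 h_red0_21 h_red2_22 h_red0_20 h_red0_33 ha hc hm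
    simp only [g3P, red0_00, bP, red0_01, q3P, red0_11, red0_32, red1_21, red2_23, red2_31, red0_31, red0_22, red2_32, red0_10, red1_01, red2_21, red0_21, red2_22, red0_20, red0_33]
    grind
  rw [h_red0_00, h_bP, h_red0_01, h_q3P, h_red0_11, h_red0_32, h_red1_21, h_red2_23, h_red2_31, h_red0_31, h_red0_22, h_red2_32, h_red0_10, h_red1_01, h_red2_21, h_red0_21, h_red2_22, h_red0_20, h_red0_33] at key
  simpa [ha, hc, hm] using key

lemma q1P_zero (a b c d t u m : K) (ha : a ≠ 0) (hc : c ≠ 0) (hm : m ≠ 0)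
    (h_red0_00 : red0_00 a b c d t u m = 0)
    (h_bP : bP a b c d t u m = 0)
    (h_q3P : q3P a b c d t u m = 0)
    (h_g3P : g3P a b c d t u m = 0)
    (h_red0_11 : red0_11 a b c d t u m = 0)
    (h_red0_01 : red0_01 a b c d t u m = 0)
    (h_red2_32 : red2_32 a b c d t u m = 0)
    (h_red0_10 : red0_10 a b c d t u m = 0)
    (h_red0_32 : red0_32 a b c d t u m = 0)
    (h_red0_21 : red0_21 a b c d t u m = 0) :
    q1P a b c d t u m = 0 := by
  have key : (a*c) * q1P a b c d t u m =
      (a*b*c*c*m + a*c*c*m*m + a*b*c*u + a*c*t*m + a*c*u*m + c*c*u*m + a*c*c + a*t*t + a*t*u + b*b*c + c*t*u + c*u*u + d*t + a) * red0_00 a b c d t u m +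
      (a*a*a*m + a*a*c*m + a*a*u + a*c*u + a*b + a*d) * bP a b c d t u m +
      (a*b*m + a*t*u + c*d*m + b*t + d*u + c) * q3P a b c d t u m +
      (a*b*c*m + a*c*t*u + c*c*d*m + b*c*t + c*d*u + a*c) * g3P a b c d t u m +
      (a*t*m + c*t*m + t*t) * red0_11 a b c d t u m +
      (a*c*t*u + b*c*c*m + c*c*d*m + a*b*t + a*t*m + c*d*u + c*t*m) * red0_01 a b c d t u m +
      (b*t + c) * red2_32 a b c d t u m +
      (t*m + a) * red0_10 a b c d t u m +
      (b*t) * red0_32 a b c d t u m +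
      (t) * red0_21 a b c d t u m := by
    clear h_red0_00 h_bP h_q3P h_g3P h_red0_11 h_red0_01 h_red2_32 h_red0_10 h_red0_32 h_red0_21 ha hc hm
    simp only [q1P, red0_00, bP, q3P, g3P, red0_11, red0_01, red2_32, red0_10, red0_32, red0_21]
    grind
  rw [h_red0_00, h_bP, h_q3P, h_g3P, h_red0_11, h_red0_01, h_red2_32, h_red0_10, h_red0_32, h_red0_21] at key
  simpa [ha, hc, hm] using key

lemma q2P_zero (a b c d t u m : K) (ha : a ≠ 0) (hc : c ≠ 0) (hm : m ≠ 0)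
    (h_red0_00 : red0_00 a b c d t u m = 0)
    (h_q1P : q1P a b c d t u m = 0)
    (h_g3P : g3P a b c d t u m = 0)
    (h_q3P : q3P a b c d t u m = 0)
    (h_red0_01 : red0_01 a b c d t u m = 0)
    (h_red0_11 : red0_11 a b c d t u m = 0)
    (h_red0_10 : red0_10 a b c d t u m = 0) :
    q2P a b c d t u m = 0 := by
  have key : (c*m) * q2P a b c d t u m =
      (a*a*c*u + a*c*c*t + a*c*c*u + a*a*m + a*c*m + c*c*m + b) * red0_00 a b c d t u m +
      (a*c*t + c*c*t + c*c*u + u) * q1P a b c d t u m +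
      (a*c*c*m + c*c*c*m + a*m + c*m + u) * g3P a b c d t u m +
      (c*t + c*u + m) * q3P a b c d t u m +
      (c*c*c*m + c*d + c*m) * red0_01 a b c d t u m +
      (c*m) * red0_11 a b c d t u m +
      (d) * red0_10 a b c d t u m := by
    clear h_red0_00 h_q1P h_g3P h_q3P h_red0_01 h_red0_11 h_red0_10 ha hc hm
    simp only [q2P, red0_00, q1P, g3P, q3P, red0_01, red0_11, red0_10]
    grind
  rw [h_red0_00, h_q1P, h_g3P, h_q3P, h_red0_01, h_red0_11, h_red0_10] at key
  simpa [ha, hc, hm] using key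

lemma gbP_zero (a b c d t u m : K) (ha : a ≠ 0) (hc : c ≠ 0) (hm : m ≠ 0)
    (h_q1P : q1P a b c d t u m = 0)
    (h_g3P : g3P a b c d t u m = 0)
    (h_red0_01 : red0_01 a b c d t u m = 0) :
    gbP a b c d t u m = 0 := by
  have key : gbP a b c d t u m =
      q1P a b c d t u m +
      g3P a b c d t u m +
      red0_01 a b c d t u m := by
    clear h_q1P h_g3P h_red0_01 ha hc hm
    simp only [gbP, q1P, g3P, red0_01]
    grind
  rw [h_q1P, h_g3P, h_red0_01] at key
  simpa [ha, hc, hm] using key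

lemma gdP_zero (a b c d t u m : K) (ha : a ≠ 0) (hc : c ≠ 0) (hm : m ≠ 0)
    (h_q1P : q1P a b c d t u m = 0)
    (h_g3P : g3P a b c d t u m = 0)
    (h_gbP : gbP a b c d t u m = 0)
    (h_red0_32 : red0_32 a b c d t u m = 0)
    (h_red2_32 : red2_32 a b c d t u m = 0)
    (h_red0_10 : red0_10 a b c d t u m = 0) :
    gdP a b c d t u m = 0 := by
  have key : (a) * gdP a b c d t u m =
      (c) * q1P a b c d t u m +
      (a + c) * g3P a b c d t u m +
      (a + c) * gbP a b c d t u m +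
      red0_32 a b c d t u m +
      red2_32 a b c d t u m +
      red0_10 a b c d t u m := by
    clear h_q1P h_g3P h_gbP h_red0_32 h_red2_32 h_red0_10 ha hc hm
    simp only [gdP, q1P, g3P, gbP, red0_32, red2_32, red0_10]
    grind
  rw [h_q1P, h_g3P, h_gbP, h_red0_32, h_red2_32, h_red0_10] at key
  simpa [ha, hc, hm] using key


/-- A rotated form of the word equation. -/
lemma rot_one {R : Type*} [Ring R] (p p' q q' : R) (hp : p * p' = 1) (hp' : p' * p = 1)
    (hq : q * q' = 1) (hq' : q' * q = 1)
    (h : (p' * q * p') * (q' * p * p) = (q * p' * p') * (q' * p * q')) :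
    (q' * p * p) * (q * p' * q) = (p * q' * p) * (q * p' * p') := by
  set z : Rˣ := ⟨p, p', hp, hp'⟩ with hz
  set w : Rˣ := ⟨q, q', hq, hq'⟩ with hw
  have h' : (z⁻¹ * w * z⁻¹) * (w⁻¹ * z * z) = (w * z⁻¹ * z⁻¹) * (w⁻¹ * z * w⁻¹) := Units.ext h
  have h3 : (w⁻¹ * z * z) * (w * z⁻¹ * w) = (z * w⁻¹ * z) * (w * z⁻¹ * z⁻¹) := by
    have h4 := congrArg (fun g => z * w⁻¹ * z * g * (w * z⁻¹ * w)) h'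
    simpa [mul_assoc] using h4
  exact congrArg Units.val h3

/-- Another rotated form of the word equation. -/
lemma rot_two {R : Type*} [Ring R] (p p' q q' : R) (hp : p * p' = 1) (hp' : p' * p = 1)
    (hq : q * q' = 1) (hq' : q' * q = 1)
    (h : (p' * q * p') * (q' * p * p) = (q * p' * p') * (q' * p * q')) :
    (p * p * q) * (p' * q * p) = (q * p * q') * (p * q * p') := by
  set z : Rˣ := ⟨p, p', hp, hp'⟩ with hz
  set w : Rˣ := ⟨q, q', hq, hq'⟩ with hw
  have h' : (z⁻¹ * w * z⁻¹) * (w⁻¹ * z * z) = (w * z⁻¹ * z⁻¹) * (w⁻¹ * z * w⁻¹) := Units.ext h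
  have h3 : (z * z * w) * (z⁻¹ * w * z) = (w * z * w⁻¹) * (z * w * z⁻¹) := by
    have h4 := congrArg (fun g => w * z * w⁻¹ * z * g * (w * z⁻¹ * w * z)) h'
    simpa [mul_assoc] using h4
  exact congrArg Units.val h3

lemma matM_mul_matMi (α β α₀ τ : K) : matM α β α₀ τ * matMi α β α₀ τ = 1 := by
  ext i j
  fin_cases i <;> fin_cases j <;> simp [matM, matMi, Matrix.mul_apply, Fin.sum_univ_four] <;>
    grind

lemma matMi_mul_matM (α β α₀ τ : K) : matMi α β α₀ τ * matM α β α₀ τ = 1 :=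
  mul_eq_one_comm.mp (matM_mul_matMi α β α₀ τ)

/-- All polynomial consequences of the word equation that are needed. -/
lemma word_consequences (a b c d v t x s : K) (hx : x ≠ 0) (hc : c ≠ 0)
    (h : ((matMi a b v t) * (matM c d x s) * (matMi a b v t)) * ((matMi c d x s) * (matM a b v t) * (matM a b v t)) =
      ((matM c d x s) * (matMi a b v t) * (matMi a b v t)) * ((matMi c d x s) * (matM a b v t) * (matMi c d x s))) :
    a ≠ 0 ∧ ∃ u m : K, m ≠ 0 ∧ v = u + a * m ∧ x = a * m ∧
      s = t + (a + c) * (a * u + m) ∧ q1P a b c d t u m = 0 ∧ q2P a b c d t u m = 0 ∧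
      q3P a b c d t u m = 0 ∧ bP a b c d t u m = 0 ∧ gbP a b c d t u m = 0 ∧
      gdP a b c d t u m = 0 := by
  have hX := matM_mul_matMi a b v t
  have hX' := matMi_mul_matM a b v t
  have hY := matM_mul_matMi c d x s
  have hY' := matMi_mul_matM c d x s
  have h1 := rot_one _ _ _ _ hX hX' hY hY' h
  have h2 := rot_two _ _ _ _ hX hX' hY hY' h
  obtain ⟨hent0_00, hent0_01, hent0_02, hent0_10, hent0_11, hent0_12, hent0_13, hent0_20, hent0_21, hent0_22, hent0_23, hent0_31, hent0_32, hent0_33⟩ :=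
    rot0_entries a b c d v t x s h
  obtain ⟨hent1_00, hent1_01, hent1_10, hent1_11, hent1_20, hent1_21, hent1_23⟩ :=
    rot1_entries a b c d v t x s h1
  obtain ⟨hent2_00, hent2_20, hent2_21, hent2_22, hent2_23, hent2_30, hent2_31, hent2_32⟩ :=
    rot2_entries a b c d v t x s h2
  have ht := cert_trace a b c d v t x s hent0_01 hent1_23 hent0_11 hent1_11 hent1_00 hent0_00 hent2_30 hent2_32 hent2_31 hent0_22 hent1_10 hent0_23 hent2_21 hent1_21 hent0_12 hent0_21 hent2_20 hent0_02 hent1_20 hent0_13 hent2_00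
  have ht' : a * (t + s) + (a + c) * (a ^ 2 * (x + v) + x) = 0 := by
    simpa [hx, hc] using ht
  have ha : a ≠ 0 := by
    rintro rfl
    apply mul_ne_zero hc hx
    linear_combination ht'
  refine ⟨ha, v + x, x / a, div_ne_zero hx ha, ?_⟩
  have h_two : (2 : K) = 0 := CharTwo.two_eq_zero
  obtain ⟨m, hm⟩ : ∃ m, x = a * m := ⟨x / a, by field_simp⟩
  obtain ⟨u, hu⟩ : ∃ u, v = u + a * m := ⟨v + x, by linear_combination (-x) * h_two + hm⟩
  have hs : s = t + (a + c) * (a * u + m) := by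
    apply mul_left_cancel₀ ha
    subst hm hu
    linear_combination ht' - a * t * h_two + (a * m * (a + c) * (-1 - a ^ 2) - a*a * u * (a + c)) * h_two
  subst hm hu hs
  have hm : m ≠ 0 := right_ne_zero_of_mul hx
  have e1 : u + a * m + a * m = u := by linear_combination a * m * h_two
  rw [e1, mul_div_cancel_left₀ m ha]
  have hred0_00 := red0_00_zero a b c d t u m ha hc hm hent0_00
  have hred0_01 := red0_01_zero a b c d t u m ha hc hm hent0_01
  have hred0_32 := red0_32_zero a b c d t u m ha hc hm hent0_32
  have hred2_21 := red2_21_zero a b c d t u m ha hc hm hent2_21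
  have hred2_23 := red2_23_zero a b c d t u m ha hc hm hent2_23
  have hred0_21 := red0_21_zero a b c d t u m ha hc hm hent0_21
  have hred0_11 := red0_11_zero a b c d t u m ha hc hm hent0_11
  have hred0_22 := red0_22_zero a b c d t u m ha hc hm hent0_22
  have hred2_32 := red2_32_zero a b c d t u m ha hc hm hent2_32
  have hred0_10 := red0_10_zero a b c d t u m ha hc hm hent0_10
  have hred1_01 := red1_01_zero a b c d t u m ha hc hm hent1_01
  have hred2_31 := red2_31_zero a b c d t u m ha hc hm hent2_31
  have hred2_22 := red2_22_zero a b c d t u m ha hc hm hent2_22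
  have hred0_31 := red0_31_zero a b c d t u m ha hc hm hent0_31
  have hred1_20 := red1_20_zero a b c d t u m ha hc hm hent1_20
  have hred0_33 := red0_33_zero a b c d t u m ha hc hm hent0_33
  have hred2_20 := red2_20_zero a b c d t u m ha hc hm hent2_20
  have hred1_21 := red1_21_zero a b c d t u m ha hc hm hent1_21
  have hred0_20 := red0_20_zero a b c d t u m ha hc hm hent0_20
  have hq3P := q3P_zero a b c d t u m ha hc hm hred0_00 hred0_01 hred0_32 hred2_21 hred2_23 hred0_21 hred0_11 hred0_22 hred2_32 hred0_10 hred1_01 hred2_31 hred2_22 hred0_31 hred1_20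
  have hbP := bP_zero a b c d t u m ha hc hm hred0_00 hred0_33 hred0_31 hq3P hred0_01 hred1_01 hred0_32 hred2_20
  have hg3P := g3P_zero a b c d t u m ha hc hm hred0_00 hbP hred0_01 hq3P hred0_11 hred0_32 hred1_21 hred2_23 hred2_31 hred0_31 hred0_22 hred2_32 hred0_10 hred1_01 hred2_21 hred0_21 hred2_22 hred0_20 hred0_33
  have hq1P := q1P_zero a b c d t u m ha hc hm hred0_00 hbP hq3P hg3P hred0_11 hred0_01 hred2_32 hred0_10 hred0_32 hred0_21
  have hq2P := q2P_zero a b c d t u m ha hc hm hred0_00 hq1P hg3P hq3P hred0_01 hred0_11 hred0_10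
  have hgbP := gbP_zero a b c d t u m ha hc hm hq1P hg3P hred0_01
  have hgdP := gdP_zero a b c d t u m ha hc hm hq1P hg3P hgbP hred0_32 hred2_32 hred0_10
  exact ⟨rfl, rfl, rfl, hq1P, hq2P, hq3P, hbP, hgbP, hgdP⟩
/-- The zero set of a nonzero polynomial of degree at most three is finite. -/
lemma cubic_finite (k3 k2 k1 k0 : K) (h : k3 ≠ 0 ∨ k2 ≠ 0 ∨ k1 ≠ 0 ∨ k0 ≠ 0) :
    {z : K | k3 * z ^ 3 + k2 * z ^ 2 + k1 * z + k0 = 0}.Finite := by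
  classical
  have hf : (Cubic.mk k3 k2 k1 k0).toPoly ≠ 0 := by
    rw [Ne, Cubic.toPoly_eq_zero_iff, Cubic.ext_iff]
    rintro ⟨e3, e2, e1, e0⟩
    have e3' : k3 = 0 := e3
    have e2' : k2 = 0 := e2
    have e1' : k1 = 0 := e1
    have e0' : k0 = 0 := e0
    tauto
  refine ((Cubic.mk k3 k2 k1 k0).toPoly.roots.toFinset.finite_toSet).subset ?_
  intro z hz
  simp only [Set.mem_ofPred_eq] at hz
  rw [Finset.mem_coe, Multiset.mem_toFinset, Polynomial.mem_roots hf]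
  simpa [Cubic.toPoly] using hz

/-- Fibres of the reduced system in the coordinates `(b, d, t, u, m)` are finite. -/
lemma reduced_finite (a c : K) (ha : a ≠ 0) (hc : c ≠ 0) :
    {z : K × K × K × K × K | z.2.2.2.2 ≠ 0 ∧
      q1P a z.1 c z.2.1 z.2.2.1 z.2.2.2.1 z.2.2.2.2 = 0 ∧
      q2P a z.1 c z.2.1 z.2.2.1 z.2.2.2.1 z.2.2.2.2 = 0 ∧
      q3P a z.1 c z.2.1 z.2.2.1 z.2.2.2.1 z.2.2.2.2 = 0 ∧
      bP a z.1 c z.2.1 z.2.2.1 z.2.2.2.1 z.2.2.2.2 = 0 ∧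
      gbP a z.1 c z.2.1 z.2.2.1 z.2.2.2.1 z.2.2.2.2 = 0 ∧
      gdP a z.1 c z.2.1 z.2.2.1 z.2.2.2.1 z.2.2.2.2 = 0}.Finite := by
  have h_two : (2 : K) = 0 := CharTwo.two_eq_zero
  by_cases he : a + c = 0
  · -- the fibre is empty when `a = c`
    have hca : c = a := by linear_combination he - a * h_two
    subst hca
    convert Set.finite_empty
    ext ⟨b, d, t, u, m⟩
    simp only [Set.mem_ofPred_eq, Set.mem_empty_iff_false, iff_false]
    rintro ⟨hm, h1, h2, h3, -⟩
    simp only [q1P, q2P, q3P] at h1 h2 h3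
    have e1 : c * (c * c * t * t + 1) = 0 := by
      clear h1 ha hc hm he
      linear_combination (norm := skip) c * h2 + h3
      clear h2 h3
      grind
    have e2 : (1 + c * c) * (t * t) = 0 := by
      linear_combination (norm := skip) h1 + h2
      clear h1 h2 h3 e1 ha hc hm he
      grind
    have e1' : c * c * t * t + 1 = 0 := by simpa [hc] using e1
    have ht : t ≠ 0 := by
      rintro rfl
      simp at e1'
    have e3 : 1 + c * c = 0 := by simpa [ht] using e2
    have e4 : (1 + c) * (1 + c) = 0 := by linear_combination e3 + c * h_two
    have e5 : c = 1 := by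
      have := mul_self_eq_zero.mp e4
      linear_combination this - h_two
    subst e5
    have e6 : (1 + t) * (1 + t) = 0 := by linear_combination e1' + t * h_two
    have e7 : t = 1 := by
      have := mul_self_eq_zero.mp e6
      linear_combination this - h_two
    subst e7
    apply hm
    clear e1 e2 e1' e3 e4 e6 he ha hc hm
    linear_combination (norm := skip) h2
    clear h1 h2 h3
    grind
  · have hT : {t : K | (a * (a * a * c + a)) * (t ^ 2) ^ 3 +
        (a * (a * a * c + a + c * (a + c) ^ 2 + a) + (a * a * c + a + c) ^ 2 + c ^ 2 * (1 + a ^ 2))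
          * (t ^ 2) ^ 2 +
        (a * (c * (a + c) ^ 2 + a) + c ^ 2 * (a + c) ^ 2) * t ^ 2 +
        (c * (a + c) ^ 2 + a) ^ 2 = 0}.Finite := by
      have hfin := cubic_finite (a * (a * a * c + a))
        (a * (a * a * c + a + c * (a + c) ^ 2 + a) + (a * a * c + a + c) ^ 2 + c ^ 2 * (1 + a ^ 2))
        (a * (c * (a + c) ^ 2 + a) + c ^ 2 * (a + c) ^ 2) ((c * (a + c) ^ 2 + a) ^ 2) (by
          by_cases hl : c * (a + c) ^ 2 + a = 0
          · right; right; left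
            rw [hl]
            simp [hc, he]
          · right; right; right
            exact pow_ne_zero 2 hl)
      refine (hfin.preimage (f := fun t : K => t ^ 2) ?_)
      intro y _ z _ hyz
      have h0 : (y + z) * (y + z) = 0 := by
        have : y ^ 2 = z ^ 2 := hyz
        linear_combination this + (z ^ 2 + y * z) * h_two
      have h1 := mul_self_eq_zero.mp h0
      linear_combination h1 - z * h_two
    have hM (t : K) : {m : K | 0 * m ^ 3 + (c * (a + c) ^ 2) * m ^ 2 +
        (a * t * (t + 1) ^ 2 * (a + c)) * m +
        (a * t * (t + 1) ^ 2 * t + c * ((1 + a ^ 2) * t ^ 2 + (a + c) ^ 2)) = 0}.Finite :=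
      cubic_finite _ _ _ _ (by right; left; simp [hc, he])
    have hB (t u m : K) : {b : K | 0 * b ^ 3 + 1 * b ^ 2 + (a * a * m + a * u) * b +
        (a*a*t*u + a*c*t*u + c*c*m*m + c*t*m + a*a + t*u + u*u + 1) = 0}.Finite :=
      cubic_finite _ _ _ _ (by right; left; exact one_ne_zero)
    have hD (b t u m : K) : {d : K | 0 * d ^ 3 + 1 * d ^ 2 + (c * u) * d +
        (a*a*u*u + a*c*t*u + a*c*u*u + b*c*c*m + c*c*m*m + c*c) = 0}.Finite :=
      cubic_finite _ _ _ _ (by right; left; exact one_ne_zero)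
    let uf : K → K → K := fun t m => (t + 1) ^ 2 * (t + (a + c) * m) / (c * (a + c))
    refine (hT.biUnion fun t _ => (hM t).biUnion fun m _ => (hB t (uf t m) m).biUnion fun b _ =>
      (hD b t (uf t m) m).biUnion fun d _ => Set.finite_singleton (b, d, t, uf t m, m)).subset ?_
    rintro ⟨b, d, t, u, m⟩ ⟨hm, h1, h2, h3, h4, h5, h6⟩
    simp only [q1P, q2P, q3P, bP, gbP, gdP] at h1 h2 h3 h4 h5 h6
    have hu : u = uf t m := by
      simp only [uf]
      rw [eq_div_iff (mul_ne_zero hc he)]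
      linear_combination (norm := skip) h4
      clear h1 h2 h3 h4 h5 h6 hm hT hM hB hD uf ha hc he
      grind
    have f1 : t * t * (a * a * c + a + c) + c * (a + c) * t * m + c * (a + c) * (a + c) + a = 0 := by
      linear_combination (norm := skip) c * h2 + h3
      clear h1 h2 h3 h4 h5 h6 hm hT hM hB hD hu uf ha hc he
      grind
    have f3 : a * t * (t + 1) ^ 2 * (t + (a + c) * m) +
        c * ((a + c) ^ 2 * m ^ 2 + (1 + a ^ 2) * t ^ 2 + (a + c) ^ 2) = 0 := by
      linear_combination (norm := skip) c * h1 + c * h2 + a * t * h4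
      clear h1 h2 h3 h4 h5 h6 hm hT hM hB hD hu uf ha hc he f1
      grind
    subst hu
    simp only [Set.mem_iUnion, Set.mem_ofPred_eq, Set.mem_singleton_iff, exists_prop]
    refine ⟨t, ?_, m, ?_, b, ?_, d, ?_, rfl⟩
    · linear_combination (norm := skip) c * t ^ 2 * f3 + (a * t ^ 2 * (t + 1) ^ 2 +
        (a * a * c + a + c) * t ^ 2 + (c * (a + c) ^ 2 + a) + c * t * (a + c) * m) * f1
      clear h1 h2 h3 h4 h5 h6 hm hT hM hB hD uf ha hc he f1 f3
      grind
    · linear_combination f3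
    · linear_combination h5
    · linear_combination h6

end Algebra

section Bridge

lemma map_matM (p : Fin 8 → AlgebraicClosure (ZMod 2)) (i j k l : Fin 8) :
    (Tmat * Smat (X i) (X j) (X k) (X l)).map (MvPolynomial.aeval p : SuzukiRing →ₐ[ZMod 2] _) =
      matM (p i) (p j) (p k) (p i ^ 2 * p k + p i * p j + p l + p k) := by
  have h_two : (2 : AlgebraicClosure (ZMod 2)) = 0 := CharTwo.two_eq_zero
  ext r s
  fin_cases r <;> fin_cases s <;>
    simp [Tmat, Smat, matM, Matrix.mul_apply, Fin.sum_univ_four]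
  linear_combination (-p k) * h_two

lemma adjugate_matM {K : Type*} [Field K] [CharP K 2] (α β α₀ τ : K) :
    (matM α β α₀ τ).adjugate = matMi α β α₀ τ := by
  have hdet : (matM α β α₀ τ).det = 1 := by
    simp [matM, Matrix.det_succ_row_zero, Fin.sum_univ_succ, Fin.succAbove]
    norm_num
  have h := Matrix.adjugate_mul (matM α β α₀ τ)
  rw [hdet, one_smul] at h
  exact left_inv_eq_right_inv h (matM_mul_matMi α β α₀ τ)

/-- The word equation holds at every point of `V′`. -/
lemma word_equation (p : Fin 8 → AlgebraicClosure (ZMod 2))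
    (h : ∀ g : SuzukiRing, (X 0) ^ 3 * (X 6) ^ 2 * g ∈ IV → MvPolynomial.aeval p g = 0)
    (a b c d v t x s : AlgebraicClosure (ZMod 2)) (ha : a = p 0) (hb : b = p 1) (hc : c = p 2)
    (hd : d = p 3) (hv : v = p 4) (hx : x = p 6)
    (ht : t = p 0 ^ 2 * p 4 + p 0 * p 1 + p 5 + p 4)
    (hs : s = p 2 ^ 2 * p 6 + p 2 * p 3 + p 7 + p 6) :
    ((matMi a b v t) * (matM c d x s) * (matMi a b v t)) *
        ((matMi c d x s) * (matM a b v t) * (matM a b v t)) =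
      ((matM c d x s) * (matMi a b v t) * (matMi a b v t)) *
        ((matMi c d x s) * (matM a b v t) * (matMi c d x s)) := by
  set f : SuzukiRing →ₐ[ZMod 2] AlgebraicClosure (ZMod 2) := MvPolynomial.aeval p with hf
  have hXm : f.mapMatrix Xmat = matM a b v t := by
    subst ha hb hv ht
    exact map_matM p 0 1 4 5
  have hYm : f.mapMatrix Ymat = matM c d x s := by
    subst hc hd hx hs
    exact map_matM p 2 3 6 7
  have hXa : f.mapMatrix Xmat.adjugate = matMi a b v t := by
    rw [AlgHom.map_adjugate, hXm, adjugate_matM]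
  have hYa : f.mapMatrix Ymat.adjugate = matMi c d x s := by
    rw [AlgHom.map_adjugate, hYm, adjugate_matM]
  have hz : f.mapMatrix
      (Xmat.adjugate * Ymat * Xmat.adjugate * Ymat.adjugate * Xmat * Xmat
        - Ymat * Xmat.adjugate * Xmat.adjugate * Ymat.adjugate * Xmat * Ymat.adjugate) = 0 := by
    ext i j
    exact h _ (IV.mul_mem_left _ (Ideal.subset_span ⟨(i, j), rfl⟩))
  rw [map_sub, sub_eq_zero] at hz
  simp only [map_mul, hXm, hYm, hXa, hYa] at hz
  simpa only [mul_assoc] using hz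

end Bridge

/-- The projection `π : U → 𝔸²`, `π(a,b,c,d,v,w,x,y) = (a,c)`, is quasifinite: every
fibre over a point of `𝔸²` is finite.  Here `U = V′ ∖ V(xc)` and `V′` is the zero set
of the ideal quotient `J = I_V : a³x²` over an algebraic closure `k` of `𝔽₂`. -/
theorem projection_quasifinite (a₀ c₀ : AlgebraicClosure (ZMod 2)) :
    Set.Finite {p : Fin 8 → AlgebraicClosure (ZMod 2) |
      (∀ g : SuzukiRing, (X 0) ^ 3 * (X 6) ^ 2 * g ∈ IV →
        MvPolynomial.aeval p g = 0) ∧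
      p 6 * p 2 ≠ 0 ∧ p 0 = a₀ ∧ p 2 = c₀} := by
  have h_two : (2 : AlgebraicClosure (ZMod 2)) = 0 := CharTwo.two_eq_zero
  by_cases hac : a₀ ≠ 0 ∧ c₀ ≠ 0
  · obtain ⟨ha, hc⟩ := hac
    refine ((reduced_finite a₀ c₀ ha hc).image (fun z =>
      (![a₀, z.1, c₀, z.2.1, z.2.2.2.1 + a₀ * z.2.2.2.2,
        z.2.2.1 - a₀ ^ 2 * (z.2.2.2.1 + a₀ * z.2.2.2.2) - a₀ * z.1
          - (z.2.2.2.1 + a₀ * z.2.2.2.2),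
        a₀ * z.2.2.2.2,
        z.2.2.1 + (a₀ + c₀) * (a₀ * z.2.2.2.1 + z.2.2.2.2) - c₀ ^ 2 * (a₀ * z.2.2.2.2)
          - c₀ * z.2.1 - a₀ * z.2.2.2.2] : Fin 8 → AlgebraicClosure (ZMod 2)))).subset ?_
    rintro p ⟨hJ, hxc, hp0, hp2⟩
    obtain ⟨-, u, m, hm, hv, hx, hs, h1, h2, h3, h4, h5, h6⟩ :=
      word_consequences a₀ (p 1) c₀ (p 3) (p 4) _ (p 6) _ (left_ne_zero_of_mul hxc) hc
        (word_equation p hJ a₀ (p 1) c₀ (p 3) (p 4) _ (p 6) _ hp0.symm rfl hp2.symm rfl rfl rfl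
          rfl rfl)
    refine ⟨(p 1, p 3, _, u, m), ⟨hm, h1, h2, h3, h4, h5, h6⟩, ?_⟩
    rw [hp0, hp2] at hs
    ext i
    fin_cases i
    · exact hp0.symm
    · rfl
    · exact hp2.symm
    · rfl
    · exact hv.symm
    · simp [← hv, hp0]
      ring
    · exact hx.symm
    · simp [← hx, hp0, ← hs]
      ring
  · convert Set.finite_empty
    ext p
    simp only [Set.mem_ofPred_eq, Set.mem_empty_iff_false, iff_false]
    rintro ⟨hJ, hxc, hp0, hp2⟩
    have hc : p 2 ≠ 0 := right_ne_zero_of_mul hxc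
    obtain ⟨ha, -⟩ :=
      word_consequences (p 0) (p 1) (p 2) (p 3) (p 4) _ (p 6) _ (left_ne_zero_of_mul hxc) hc
        (word_equation p hJ (p 0) (p 1) (p 2) (p 3) (p 4) _ (p 6) _ rfl rfl rfl rfl rfl rfl
          rfl rfl)
    exact hac ⟨hp0 ▸ ha, hp2 ▸ hc⟩

end
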